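/- arXiv:1707.08896 — 6 statements merged into one kernel-verified Lean document; each statement's English description precedes it below -/
import Mathlib

section
/- Let n ≥ 1 and let ∗ be a bilinear multiplication on A = (Fin n → ℝ) making (A, ∗) a triangularizable left-symmetric algebra whose trace form τ is nondegenerate and whose derived Lie subalgebra span{x∗y − y∗x : x, y ∈ A} has dimension n − 1. Let P(x) = det(id_A + R(x)) be the characteristic polynomial and let r be the right principal idempotent, i.e. the unique r ∈ A with τ(r, x) = tr R(x) for all x. Then r∗r = r, tr R(r) = 1, P(x + t·r) = P(x) + t for all x ∈ A and t ∈ ℝ, and there is a nonzero constant κ such that the Hessian determinant of e^P satisfies H(e^P)(x) = κ·e^{n·P(x)} for every x ∈ A. -/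
noncomputable def hessianDet {m : ℕ} (F : (Fin m → ℝ) → ℝ) (x : Fin m → ℝ) : ℝ :=
  (Matrix.of fun i j : Fin m =>
    fderiv ℝ (fun y => fderiv ℝ F y (Pi.single j 1)) x (Pi.single i 1)).det

def IsLSA {n : ℕ} (mul : (Fin n → ℝ) →ₗ[ℝ] (Fin n → ℝ) →ₗ[ℝ] (Fin n → ℝ)) : Prop :=
  ∀ x y z : Fin n → ℝ,
    mul (mul x y) z - mul x (mul y z) = mul (mul y x) z - mul y (mul x z)

def Triangularizable {n : ℕ}
    (mul : (Fin n → ℝ) →ₗ[ℝ] (Fin n → ℝ) →ₗ[ℝ] (Fin n → ℝ)) : Prop :=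
  ∃ V : Fin (n + 1) → Submodule ℝ (Fin n → ℝ),
    Monotone V ∧ (∀ i : Fin (n + 1), Module.finrank ℝ (V i) = i) ∧
    ∀ x : Fin n → ℝ, ∀ i : Fin (n + 1), ∀ v ∈ V i, mul x v ∈ V i

theorem fderiv_det_apply {E m : Type*} [NormedAddCommGroup E] [NormedSpace ℝ E] [Fintype m]
    [DecidableEq m] {M : E → Matrix m m ℝ} {x : E}
    (hM : ∀ i j, DifferentiableAt ℝ (fun y => M y i j) x) (v : E) :
    fderiv ℝ (fun y => (M y).det) x v =
      ((M x).adjugate * Matrix.of fun i j => fderiv ℝ (fun y => M y i j) x v).trace := by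
  let D : ContinuousMultilinearMap ℝ (fun _ : m => m → ℝ) ℝ :=
    { (Matrix.detRowAlternating (R := ℝ) (n := m)).toMultilinearMap with
      cont := by
        change Continuous fun A : Matrix m m ℝ => A.det
        exact continuous_id.matrix_det }
  have hrow : ∀ i, HasFDerivAt (fun y => M y i)
      (ContinuousLinearMap.pi fun j => fderiv ℝ (fun y => M y i j) x) x := fun i =>
    hasFDerivAt_pi.2 fun j => (hM i j).hasFDerivAt
  have hMx : HasFDerivAt (fun y => (fun i => M y i : m → m → ℝ))
      (ContinuousLinearMap.pi fun i =>
        ContinuousLinearMap.pi fun j => fderiv ℝ (fun y => M y i j) x) x :=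
    hasFDerivAt_pi.2 hrow
  have h := (D.hasFDerivAt (fun i => M x i)).comp x hMx
  have h2 : fderiv ℝ (fun y => (M y).det) x = _ := h.fderiv
  rw [h2, ContinuousLinearMap.comp_apply, ContinuousMultilinearMap.linearDeriv_apply]
  rw [Matrix.trace_mul_comm]
  simp only [Matrix.trace, Matrix.diag]
  refine Finset.sum_congr rfl fun i _ => ?_
  have key : D (Function.update (fun i => M x i) i
      (fun j => fderiv ℝ (fun y => M y i j) x v)) =
      ((M x).updateRow i (fun j => fderiv ℝ (fun y => M y i j) x v)).det := rfl
  refine key.trans ?_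
  rw [← Matrix.cramer_transpose_apply, Matrix.cramer_eq_adjugate_mulVec,
    Matrix.mulVec, dotProduct, Matrix.mul_apply]
  refine Finset.sum_congr rfl fun j _ => ?_
  rw [← Matrix.adjugate_transpose, Matrix.transpose_apply, mul_comm]
  rfl

theorem analyticOnNhd_det {E m : Type*} [NormedAddCommGroup E] [NormedSpace ℝ E] [Fintype m]
    [DecidableEq m] {M : E → Matrix m m ℝ} {s : Set E}
    (hM : ∀ i j, AnalyticOnNhd ℝ (fun y => M y i j) s) :
    AnalyticOnNhd ℝ (fun y => (M y).det) s := by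
  simp only [Matrix.det_apply']
  refine Finset.analyticOnNhd_fun_sum _ fun σ _ => ?_
  exact analyticOnNhd_const.mul (Finset.analyticOnNhd_fun_prod _ fun i _ => hM _ _)

section

variable {E F : Type*} [NormedAddCommGroup E] [NormedSpace ℝ E] [NormedAddCommGroup F]
  [NormedSpace ℝ F]

theorem AnalyticOnNhd.clm_apply_const {H : Type*} [NormedAddCommGroup H] [NormedSpace ℝ H]
    {f : H → E →L[ℝ] F} {s : Set H} (hf : AnalyticOnNhd ℝ f s) (v : E) :
    AnalyticOnNhd ℝ (fun x => f x v) s :=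
  ((ContinuousLinearMap.apply ℝ F v).analyticOnNhd Set.univ).comp hf (Set.mapsTo_univ _ _)

/-- If `G` is equivariant along the affine vector field `x ↦ a + L x`, so is its derivative. -/
theorem fderiv_fderiv_add_apply {G : E → F} (hG : ContDiff ℝ 2 G) (L : E →L[ℝ] E) (a : E)
    (T : F →L[ℝ] F) (h : ∀ x, fderiv ℝ G x (a + L x) = T (G x)) (x w : E) :
    fderiv ℝ (fderiv ℝ G) x (a + L x) w = T (fderiv ℝ G x w) - fderiv ℝ G x (L w) := by
  have hsymm : IsSymmSndFDerivAt ℝ G x :=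
    hG.contDiffAt.isSymmSndFDerivAt (by simp)
  have hG' : DifferentiableAt ℝ (fderiv ℝ G) x :=
    (hG.fderiv_right (m := 1) (by norm_num)).differentiable (by norm_num) x
  have h1 : HasFDerivAt (fun y => fderiv ℝ G y (a + L y)) _ x :=
    hG'.hasFDerivAt.clm_apply (L.hasFDerivAt.const_add a)
  have h2 : HasFDerivAt (fun y => T (G y)) _ x :=
    T.hasFDerivAt.comp x (hG.differentiable (by norm_num) x).hasFDerivAt
  have h3 := congrArg (fun S => S w) (h1.unique (by simpa only [h] using h2))
  rw [hsymm.eq]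
  simp at h3
  rw [eq_sub_iff_add_eq, ← h3, ContinuousLinearMap.map_add]
  abel

end

open Matrix in
theorem Matrix.trace_adjugate_mul_of_mulVec_eq {m R : Type*} [Fintype m] [DecidableEq m]
    [CommRing R] {M : Matrix m m R} {p r : m → R} (hr : M *ᵥ r = p) (hpr : p ⬝ᵥ r = 1)
    (A : Matrix m m R) (c : R) :
    (M.adjugate * (c • M + c • Matrix.vecMulVec p p - Aᵀ * M - M * A)).trace =
      ((Fintype.card m + 1) * c - 2 * A.trace) * M.det := by
  have h1 : (M.adjugate * M).trace = Fintype.card m * M.det := by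
    simp [Matrix.adjugate_mul, mul_comm]
  have h2 : (M.adjugate * Matrix.vecMulVec p p).trace = M.det := by
    rw [Matrix.mul_vecMulVec, Matrix.trace_vecMulVec]
    nth_rw 1 [← hr]
    rw [Matrix.mulVec_mulVec, Matrix.adjugate_mul, Matrix.smul_mulVec, Matrix.one_mulVec,
      smul_dotProduct, dotProduct_comm, hpr, smul_eq_mul, mul_one]
  have h3 : (M.adjugate * (Aᵀ * M)).trace = A.trace * M.det := by
    rw [Matrix.trace_mul_comm, Matrix.mul_assoc, Matrix.mul_adjugate]
    simp [mul_comm]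
  have h4 : (M.adjugate * (M * A)).trace = A.trace * M.det := by
    rw [← Matrix.mul_assoc, Matrix.adjugate_mul]
    simp [mul_comm]
  simp only [Matrix.mul_sub, Matrix.mul_add, Matrix.trace_sub, Matrix.trace_add, Matrix.mul_smul,
    Matrix.trace_smul, h1, h2, h3, h4, smul_eq_mul]
  ring

section LeftSymmetric

variable {n : ℕ} {mul : (Fin n → ℝ) →ₗ[ℝ] (Fin n → ℝ) →ₗ[ℝ] (Fin n → ℝ)}

theorem IsLSA.flip_mul (h : IsLSA mul) (x z : Fin n → ℝ) :
    mul.flip (mul x z) =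
      mul.flip z ∘ₗ mul.flip x + mul x ∘ₗ mul.flip z - mul.flip z ∘ₗ mul x := by
  refine LinearMap.ext fun y => ?_
  have := h x y z
  simp only [LinearMap.flip_apply, LinearMap.sub_apply, LinearMap.add_apply,
    LinearMap.comp_apply]
  linear_combination (exp := 1) this

theorem IsLSA.mul_mul_sub (h : IsLSA mul) (x y : Fin n → ℝ) :
    mul (mul x y - mul y x) = mul x ∘ₗ mul y - mul y ∘ₗ mul x := by
  refine LinearMap.ext fun z => ?_
  have := h x y z
  rw [map_sub, LinearMap.sub_apply, LinearMap.sub_apply, LinearMap.comp_apply,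
    LinearMap.comp_apply]
  rw [sub_eq_sub_iff_sub_eq_sub] at this
  exact this

theorem IsLSA.trace_flip_mul (h : IsLSA mul) (x z : Fin n → ℝ) :
    LinearMap.trace ℝ _ (mul.flip (mul x z)) =
      LinearMap.trace ℝ _ (mul.flip x ∘ₗ mul.flip z) := by
  rw [h.flip_mul, map_sub, map_add, LinearMap.trace_comp_comm' (mul x),
    LinearMap.trace_comp_comm' (mul.flip z) (mul.flip x)]
  ring

theorem toMatrix'_id_add_flip_apply (x : Fin n → ℝ) (i j : Fin n) :
    LinearMap.toMatrix' (LinearMap.id + mul.flip x) i j =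
      (Pi.single j 1 : Fin n → ℝ) i + mul (Pi.single j 1) x i := by
  simp [LinearMap.toMatrix'_apply]

theorem analyticOnNhd_toMatrix'_id_add_flip (i j : Fin n) :
    AnalyticOnNhd ℝ (fun x => LinearMap.toMatrix' (LinearMap.id + mul.flip x) i j) Set.univ := by
  simp only [toMatrix'_id_add_flip_apply]
  refine analyticOnNhd_const.add ?_
  exact ((LinearMap.toContinuousLinearMap
    (LinearMap.proj i ∘ₗ mul (Pi.single j 1))).analyticOnNhd _)

theorem analyticOnNhd_det_id_add_flip :
    AnalyticOnNhd ℝ (fun x => LinearMap.det (LinearMap.id + mul.flip x)) Set.univ := by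
  simp only [← LinearMap.det_toMatrix']
  exact analyticOnNhd_det analyticOnNhd_toMatrix'_id_add_flip

theorem fderiv_det_id_add_flip (x v : Fin n → ℝ) :
    fderiv ℝ (fun x => LinearMap.det (LinearMap.id + mul.flip x)) x v =
      ((LinearMap.toMatrix' (LinearMap.id + mul.flip x)).adjugate *
        LinearMap.toMatrix' (mul.flip v)).trace := by
  simp only [← LinearMap.det_toMatrix']
  rw [fderiv_det_apply fun i j =>
    (analyticOnNhd_toMatrix'_id_add_flip i j x trivial).differentiableAt]
  congr 2
  ext i j
  rw [Matrix.of_apply]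
  simp only [toMatrix'_id_add_flip_apply, fderiv_const_add]
  have := (LinearMap.toContinuousLinearMap
    (LinearMap.proj i ∘ₗ mul (Pi.single j 1))).hasFDerivAt (x := x)
  have h2 : fderiv ℝ (fun x => mul (Pi.single j 1) x i) x = _ := this.fderiv
  rw [h2]
  simp [LinearMap.toMatrix'_apply]

theorem IsLSA.fderiv_det_id_add_flip_apply (h : IsLSA mul) (x a : Fin n → ℝ) :
    fderiv ℝ (fun x => LinearMap.det (LinearMap.id + mul.flip x)) x (a + mul a x) =
      LinearMap.trace ℝ _ (mul.flip a) * LinearMap.det (LinearMap.id + mul.flip x) := by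
  rw [fderiv_det_id_add_flip]
  have h1 : mul.flip (a + mul a x) = (LinearMap.id + mul.flip x) ∘ₗ mul.flip a +
      mul a ∘ₗ (LinearMap.id + mul.flip x) - (LinearMap.id + mul.flip x) ∘ₗ mul a := by
    rw [map_add, h.flip_mul, LinearMap.add_comp, LinearMap.comp_add, LinearMap.add_comp,
      LinearMap.id_comp, LinearMap.comp_id, LinearMap.id_comp]
    abel
  rw [h1, map_sub LinearMap.toMatrix', map_add LinearMap.toMatrix' (_ ∘ₗ _)]
  simp only [LinearMap.toMatrix'_comp]
  set N := LinearMap.toMatrix' (LinearMap.id + mul.flip x) with hN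
  have h2 : (N.adjugate * (LinearMap.toMatrix' (mul a) * N)).trace =
      (N.adjugate * (N * LinearMap.toMatrix' (mul a))).trace := by
    rw [Matrix.trace_mul_comm, Matrix.mul_assoc, Matrix.mul_adjugate, ← Matrix.mul_assoc,
      Matrix.adjugate_mul]
    simp
  rw [Matrix.mul_sub, Matrix.mul_add, Matrix.trace_sub, Matrix.trace_add, h2, add_sub_cancel_right,
    ← Matrix.mul_assoc, Matrix.adjugate_mul, LinearMap.trace_eq_matrix_trace ℝ (Pi.basisFun ℝ _),
    hN, LinearMap.det_toMatrix']
  simp [mul_comm, LinearMap.toMatrix_eq_toMatrix']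

/-- A function annihilated by all the vector fields `x ↦ a + a ∗ x` is constant. -/
theorem AnalyticOnNhd.eq_apply_zero_of_fderiv_add_mul_eq_zero {F : Type*} [NormedAddCommGroup F]
    [NormedSpace ℝ F] {f : (Fin n → ℝ) → F} (hf : AnalyticOnNhd ℝ f Set.univ)
    (h : ∀ x a, fderiv ℝ f x (a + mul a x) = 0) (x : Fin n → ℝ) : f x = f 0 := by
  have hU : ∀ᶠ x in nhds (0 : Fin n → ℝ), LinearMap.det (LinearMap.id + mul.flip x) ≠ 0 := by
    refine ((analyticOnNhd_det_id_add_flip (mul := mul)).continuousOn.continuousAt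
      Filter.univ_mem).eventually_ne ?_
    simp
  obtain ⟨ε, hε, hball⟩ := Metric.eventually_nhds_iff_ball.1 hU
  have hconst : f =ᶠ[nhds 0] fun _ => f 0 := by
    filter_upwards [Metric.ball_mem_nhds (0 : Fin n → ℝ) hε] with y hy
    refine Metric.isOpen_ball.is_const_of_fderiv_eq_zero (𝕜 := ℝ)
      (convex_ball _ _).isPreconnected (hf.differentiableOn.mono (Set.subset_univ _)) ?_ hy
      (Metric.mem_ball_self hε)
    intro z hz
    ext1 v
    have hdet := hball z hz
    obtain ⟨a, rfl⟩ := (LinearMap.equivOfDetNeZero _ hdet).surjective v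
    exact h z a
  exact congrFun (hf.eq_of_eventuallyEq analyticOnNhd_const hconst) x

end LeftSymmetric

/-- The matrix of the symmetric bilinear form `∇²P + dP ⊗ dP` in the standard basis. -/
noncomputable def hessianAddSq {m : ℕ} (P : (Fin m → ℝ) → ℝ) (x : Fin m → ℝ) :
    Matrix (Fin m) (Fin m) ℝ :=
  Matrix.of fun i j => fderiv ℝ (fderiv ℝ P) x (Pi.single i 1) (Pi.single j 1) +
    fderiv ℝ P x (Pi.single i 1) * fderiv ℝ P x (Pi.single j 1)

theorem hessianDet_exp {m : ℕ} {P : (Fin m → ℝ) → ℝ} (hP : ContDiff ℝ 2 P) (x : Fin m → ℝ) :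
    hessianDet (fun y => Real.exp (P y)) x = Real.exp (m * P x) * (hessianAddSq P x).det := by
  have hd : Differentiable ℝ P := hP.differentiable (by norm_num)
  have hd' : Differentiable ℝ (fderiv ℝ P) :=
    (hP.fderiv_right (m := 1) (by norm_num)).differentiable (by norm_num)
  have h1 : ∀ y v, fderiv ℝ (fun y => Real.exp (P y)) y v = Real.exp (P y) * fderiv ℝ P y v := by
    intro y v
    rw [fderiv_exp (hd y)]
    simp
  have h2 : ∀ v w, fderiv ℝ (fun y => Real.exp (P y) * fderiv ℝ P y v) x w =
      Real.exp (P x) * (fderiv ℝ (fderiv ℝ P) x w v + fderiv ℝ P x w * fderiv ℝ P x v) := by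
    intro v w
    have h3 : HasFDerivAt (fun y => Real.exp (P y) * fderiv ℝ P y v) _ x :=
      ((hd x).hasFDerivAt.exp).mul ((hd' x).hasFDerivAt.clm_apply (hasFDerivAt_const v x))
    rw [h3.fderiv]
    simp
    ring
  have h4 : (Matrix.of fun i j : Fin m => fderiv ℝ (fun y =>
      fderiv ℝ (fun y => Real.exp (P y)) y (Pi.single j 1)) x (Pi.single i 1)) =
      Real.exp (P x) • hessianAddSq P x := by
    ext i j
    simp only [Matrix.of_apply, h1, h2, hessianAddSq, Matrix.smul_apply, smul_eq_mul]
  rw [hessianDet, h4, Matrix.det_smul, Fintype.card_fin, ← Real.exp_nat_mul]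

theorem LinearMap.sum_toMatrix'_mul_apply_single {m R : Type*} [Fintype m] [DecidableEq m]
    [CommRing R] (f : (m → R) →ₗ[R] R) (A : (m → R) →ₗ[R] (m → R)) (j : m) :
    ∑ k, LinearMap.toMatrix' A k j * f (Pi.single k 1) = f (A (Pi.single j 1)) := by
  conv_rhs => rw [← Finset.univ_sum_single (A (Pi.single j 1)), map_sum]
  refine Finset.sum_congr rfl fun k _ => ?_
  rw [LinearMap.toMatrix'_apply, ← smul_eq_mul, ← map_smul, ← Pi.single_smul, smul_eq_mul, mul_one]

theorem hessianAddSq_mulVec {m : ℕ} (P : (Fin m → ℝ) → ℝ) (x w : Fin m → ℝ) (i : Fin m) :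
    (hessianAddSq P x).mulVec w i = fderiv ℝ (fderiv ℝ P) x (Pi.single i 1) w +
      fderiv ℝ P x (Pi.single i 1) * fderiv ℝ P x w := by
  conv_rhs => rw [← Finset.univ_sum_single w, map_sum, map_sum, Finset.mul_sum,
    ← Finset.sum_add_distrib]
  rw [Matrix.mulVec, dotProduct]
  refine Finset.sum_congr rfl fun j _ => ?_
  have : (Pi.single j (w j) : Fin m → ℝ) = w j • Pi.single j 1 := by
    rw [← Pi.single_smul, smul_eq_mul, mul_one]
  rw [this, map_smul, map_smul]
  simp only [hessianAddSq, Matrix.of_apply, smul_eq_mul]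
  ring

section LeftSymmetric

variable {n : ℕ} {mul : (Fin n → ℝ) →ₗ[ℝ] (Fin n → ℝ) →ₗ[ℝ] (Fin n → ℝ)}

/-- The linear form `x ↦ tr R(x)`. -/
noncomputable def rightTrace (mul : (Fin n → ℝ) →ₗ[ℝ] (Fin n → ℝ) →ₗ[ℝ] (Fin n → ℝ)) :
    (Fin n → ℝ) →ₗ[ℝ] ℝ :=
  LinearMap.trace ℝ _ ∘ₗ mul.flip

theorem IsLSA.rightTrace_mul_comm (h : IsLSA mul) (x y : Fin n → ℝ) :
    rightTrace mul (mul x y) = rightTrace mul (mul y x) := by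
  simp only [rightTrace, LinearMap.comp_apply, h.trace_flip_mul]
  exact LinearMap.trace_comp_comm' _ _

theorem IsLSA.span_commutator_eq_ker (h : IsLSA mul)
    (hder : Module.finrank ℝ
      (Submodule.span ℝ {z : Fin n → ℝ | ∃ x y, z = mul x y - mul y x}) = n - 1)
    (hne : rightTrace mul ≠ 0) :
    Submodule.span ℝ {z : Fin n → ℝ | ∃ x y, z = mul x y - mul y x} =
      LinearMap.ker (rightTrace mul) := by
  refine Submodule.eq_of_le_of_finrank_eq ?_ ?_
  · rw [Submodule.span_le]
    rintro _ ⟨x, y, rfl⟩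
    simp [h.rightTrace_mul_comm x y]
  · have := Module.Dual.finrank_ker_add_one_of_ne_zero (f := rightTrace mul) hne
    rw [Module.finrank_fin_fun] at this
    omega

theorem IsLSA.exists_mul_eq_smul_of_triangularizable (hn : 1 ≤ n) (h : IsLSA mul)
    (htri : Triangularizable mul)
    (hder : Module.finrank ℝ
      (Submodule.span ℝ {z : Fin n → ℝ | ∃ x y, z = mul x y - mul y x}) = n - 1)
    (hne : rightTrace mul ≠ 0) :
    ∃ e : Fin n → ℝ, e ≠ 0 ∧ ∃ c : ℝ, ∀ x, mul x e = (c * rightTrace mul x) • e := by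
  obtain ⟨V, -, hV, hmul⟩ := htri
  obtain ⟨e, he, hspan⟩ := finrank_eq_one_iff'.1 (hV ⟨1, by omega⟩)
  have hspan' : ∀ x, ∃ c : ℝ, mul x e = c • (e : Fin n → ℝ) := fun x => by
    obtain ⟨c, hc⟩ := hspan ⟨mul x e, hmul x _ _ e.2⟩
    exact ⟨c, (congrArg Subtype.val hc).symm⟩
  have hker : ∀ z, rightTrace mul z = 0 → mul z e = 0 := by
    intro z hz
    have hz' : z ∈ LinearMap.ker (rightTrace mul) := hz
    rw [← h.span_commutator_eq_ker hder hne] at hz'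
    have hle : Submodule.span ℝ {z : Fin n → ℝ | ∃ x y, z = mul x y - mul y x} ≤
        LinearMap.ker (mul.flip (e : Fin n → ℝ)) := by
      rw [Submodule.span_le]
      rintro _ ⟨x, y, rfl⟩
      obtain ⟨c, hc⟩ := hspan' x
      obtain ⟨d, hd⟩ := hspan' y
      change mul (mul x y - mul y x) e = 0
      rw [h.mul_mul_sub]
      simp [hc, hd, smul_smul, mul_comm]
    exact hle hz'
  obtain ⟨x₀, hx₀⟩ : ∃ x₀, rightTrace mul x₀ = 1 := LinearMap.surjective hne 1
  obtain ⟨c, hc⟩ := hspan' x₀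
  refine ⟨e, by simpa using he, c, fun x => ?_⟩
  have := hker (x - rightTrace mul x • x₀) (by simp [hx₀])
  rw [map_sub, LinearMap.sub_apply, sub_eq_zero, map_smul, LinearMap.smul_apply, hc,
    smul_smul] at this
  rw [this, mul_comm]

/-- The right principal idempotent spans a left ideal on which `L(x)` acts by `tr R(x)`. -/
theorem IsLSA.mul_right_principal_idempotent (hn : 1 ≤ n) (h : IsLSA mul)
    (htri : Triangularizable mul)
    (hnd : ∀ x, (∀ y, rightTrace mul (mul x y) = 0) → x = 0)
    (hder : Module.finrank ℝ
      (Submodule.span ℝ {z : Fin n → ℝ | ∃ x y, z = mul x y - mul y x}) = n - 1)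
    {r : Fin n → ℝ} (hr : ∀ x, rightTrace mul (mul r x) = rightTrace mul x) :
    rightTrace mul r = 1 ∧ ∀ x, mul x r = rightTrace mul x • r := by
  have hne : rightTrace mul ≠ 0 := by
    intro h0
    have : (fun _ => 1 : Fin n → ℝ) = 0 := hnd _ fun y => by simp [h0]
    simpa using congrFun this ⟨0, hn⟩
  obtain ⟨e, he, c, hc⟩ := h.exists_mul_eq_smul_of_triangularizable hn htri hder hne
  have her : e = (c * rightTrace mul e) • r := by
    rw [← sub_eq_zero]
    refine hnd _ fun y => ?_
    rw [map_sub, LinearMap.sub_apply, map_sub, map_smul, LinearMap.smul_apply, map_smul, hr,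
      h.rightTrace_mul_comm, hc, map_smul, smul_eq_mul, smul_eq_mul]
    ring
  have hk : c * rightTrace mul e ≠ 0 := fun h0 => he (by rw [her, h0, zero_smul])
  have hxr : ∀ x, mul x r = (c * rightTrace mul x) • r := fun x => by
    have h1 := hc x
    rw [her, map_smul, smul_comm] at h1
    exact smul_right_injective _ hk h1
  obtain ⟨x₀, hx₀⟩ : ∃ x₀, rightTrace mul x₀ = 1 := LinearMap.surjective hne 1
  have hcr : c * rightTrace mul r = 1 := by
    have h1 := hr x₀
    rw [h.rightTrace_mul_comm, hxr, map_smul, hx₀, smul_eq_mul, mul_one] at h1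
    exact h1
  have htr : rightTrace mul r = c * rightTrace mul r := by
    have h1 : mul.flip r = LinearMap.smulRight (c • rightTrace mul) r := by
      refine LinearMap.ext fun x => ?_
      simp [hxr]
    conv_lhs => rw [rightTrace, LinearMap.comp_apply, h1, LinearMap.trace_smulRight]
    simp
  rw [hcr] at htr
  rw [htr, mul_one] at hcr
  subst hcr
  exact ⟨htr, fun x => by rw [hxr, one_mul]⟩

end LeftSymmetric

section Characteristic

variable {n : ℕ} {mul : (Fin n → ℝ) →ₗ[ℝ] (Fin n → ℝ) →ₗ[ℝ] (Fin n → ℝ)}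
  {P : (Fin n → ℝ) → ℝ}

theorem fderiv_fderiv_add_mul_apply (hP : ContDiff ℝ 2 P)
    (hE : ∀ x a, fderiv ℝ P x (a + mul a x) = rightTrace mul a * P x) (x a w : Fin n → ℝ) :
    fderiv ℝ (fderiv ℝ P) x (a + mul a x) w =
      rightTrace mul a * fderiv ℝ P x w - fderiv ℝ P x (mul a w) :=
  fderiv_fderiv_add_apply hP (LinearMap.toContinuousLinearMap (mul a)) a
    (rightTrace mul a • ContinuousLinearMap.id ℝ ℝ) (fun x => by simpa using hE x a) x w

theorem fderiv_fderiv_fderiv_add_mul_apply (hP : ContDiff ℝ 3 P)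
    (hE : ∀ x a, fderiv ℝ P x (a + mul a x) = rightTrace mul a * P x) (x a v w : Fin n → ℝ) :
    fderiv ℝ (fderiv ℝ (fderiv ℝ P)) x (a + mul a x) v w =
      rightTrace mul a * fderiv ℝ (fderiv ℝ P) x v w -
        fderiv ℝ (fderiv ℝ P) x v (mul a w) - fderiv ℝ (fderiv ℝ P) x (mul a v) w := by
  let L := LinearMap.toContinuousLinearMap (mul a)
  let T : ((Fin n → ℝ) →L[ℝ] ℝ) →L[ℝ] ((Fin n → ℝ) →L[ℝ] ℝ) :=
    rightTrace mul a • ContinuousLinearMap.id ℝ _ -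
      (ContinuousLinearMap.compL ℝ (Fin n → ℝ) (Fin n → ℝ) ℝ).flip L
  have hT : ∀ x, fderiv ℝ (fderiv ℝ P) x (a + L x) = T (fderiv ℝ P x) := fun x => by
    ext1 w
    exact fderiv_fderiv_add_mul_apply (hP.of_le (by norm_num)) hE x a w
  exact congrArg (fun f => f w)
    (fderiv_fderiv_add_apply (hP.fderiv_right (m := 2) (by norm_num)) L a T hT x v)

/-- A vector spanning a left ideal of weight `tr R` is a direction in which `P` is affine. -/
theorem fderiv_apply_eq_of_mul_eq_smul (hP : AnalyticOnNhd ℝ P Set.univ)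
    (hE : ∀ x a, fderiv ℝ P x (a + mul a x) = rightTrace mul a * P x)
    {r : Fin n → ℝ} (hr : ∀ x, mul x r = rightTrace mul x • r) (x : Fin n → ℝ) :
    fderiv ℝ P x r = fderiv ℝ P 0 r := by
  refine (hP.fderiv.clm_apply_const r).eq_apply_zero_of_fderiv_add_mul_eq_zero (mul := mul)
    (fun x a => ?_) x
  have h1 : HasFDerivAt (fun x => fderiv ℝ P x r) _ x :=
    (hP.fderiv x trivial).differentiableAt.hasFDerivAt.clm_apply (hasFDerivAt_const r x)
  rw [h1.fderiv]
  have h2 := fderiv_fderiv_add_mul_apply hP.contDiff hE x a r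
  rw [hr, map_smul, smul_eq_mul, sub_self] at h2
  simpa using h2

theorem analyticOnNhd_hessianAddSq (hP : AnalyticOnNhd ℝ P Set.univ) (i j : Fin n) :
    AnalyticOnNhd ℝ (fun x => hessianAddSq P x i j) Set.univ :=
  ((hP.fderiv.fderiv.clm_apply_const _).clm_apply_const _).add
    ((hP.fderiv.clm_apply_const _).mul (hP.fderiv.clm_apply_const _))

theorem fderiv_det_hessianAddSq (hP : AnalyticOnNhd ℝ P Set.univ)
    (hE : ∀ x a, fderiv ℝ P x (a + mul a x) = rightTrace mul a * P x)
    {r : Fin n → ℝ} (hr : ∀ x, fderiv ℝ P x r = 1) (x a : Fin n → ℝ) :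
    fderiv ℝ (fun x => (hessianAddSq P x).det) x (a + mul a x) =
      ((n + 1) * rightTrace mul a - 2 * LinearMap.trace ℝ _ (mul a)) *
        (hessianAddSq P x).det := by
  have hd : HasFDerivAt (fderiv ℝ P) (fderiv ℝ (fderiv ℝ P) x) x :=
    (hP.fderiv x trivial).differentiableAt.hasFDerivAt
  have hd' : HasFDerivAt (fderiv ℝ (fderiv ℝ P)) (fderiv ℝ (fderiv ℝ (fderiv ℝ P)) x) x :=
    (hP.fderiv.fderiv x trivial).differentiableAt.hasFDerivAt
  have hrr : ∀ v, fderiv ℝ (fderiv ℝ P) x v r = 0 := fun v => by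
    have h1 : HasFDerivAt (fun x => fderiv ℝ P x r) _ x := hd.clm_apply (hasFDerivAt_const r x)
    simp only [hr] at h1
    simpa using (congrArg (fun f => f v) ((hasFDerivAt_const (1 : ℝ) x).unique h1)).symm
  rw [fderiv_det_apply fun i j => (analyticOnNhd_hessianAddSq hP i j x trivial).differentiableAt]
  set p : Fin n → ℝ := fun i => fderiv ℝ P x (Pi.single i 1) with hp
  have hMr : (hessianAddSq P x).mulVec r = p := by
    ext i
    rw [hessianAddSq_mulVec, hrr, hr, zero_add, mul_one]
  have hpr : p ⬝ᵥ r = 1 := by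
    rw [← hr x]
    conv_rhs => rw [← Finset.univ_sum_single r, map_sum]
    refine Finset.sum_congr rfl fun j _ => ?_
    rw [hp, mul_comm, ← smul_eq_mul, ← map_smul, ← Pi.single_smul, smul_eq_mul, mul_one]
  have hN : (Matrix.of fun i j => fderiv ℝ (fun y => hessianAddSq P y i j) x (a + mul a x)) =
      rightTrace mul a • hessianAddSq P x + rightTrace mul a • Matrix.vecMulVec p p -
        (LinearMap.toMatrix' (mul a)).transpose * hessianAddSq P x -
        hessianAddSq P x * LinearMap.toMatrix' (mul a) := by
    ext i j
    have hij : HasFDerivAt (fun y => hessianAddSq P y i j) _ x :=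
      ((hd'.clm_apply (hasFDerivAt_const (Pi.single i 1) x)).clm_apply
        (hasFDerivAt_const (Pi.single j 1) x)).add
      ((hd.clm_apply (hasFDerivAt_const (Pi.single i 1) x)).mul
        (hd.clm_apply (hasFDerivAt_const (Pi.single j 1) x)))
    have hleft : ((LinearMap.toMatrix' (mul a)).transpose * hessianAddSq P x) i j =
        fderiv ℝ (fderiv ℝ P) x (mul a (Pi.single i 1)) (Pi.single j 1) +
          fderiv ℝ P x (mul a (Pi.single i 1)) * fderiv ℝ P x (Pi.single j 1) := by
      have hsum := LinearMap.sum_toMatrix'_mul_apply_single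
        (((fderiv ℝ (fderiv ℝ P) x).flip (Pi.single j 1) +
          fderiv ℝ P x (Pi.single j 1) • fderiv ℝ P x).toLinearMap) (mul a) i
      simp only [ContinuousLinearMap.coe_coe, add_apply, smul_apply,
        ContinuousLinearMap.flip_apply, smul_eq_mul] at hsum
      rw [mul_comm (fderiv ℝ P x _), ← hsum, Matrix.mul_apply]
      refine Finset.sum_congr rfl fun k _ => ?_
      rw [Matrix.transpose_apply, hessianAddSq, Matrix.of_apply,
        mul_comm (fderiv ℝ P x (Pi.single k 1))]
    have hright : (hessianAddSq P x * LinearMap.toMatrix' (mul a)) i j =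
        fderiv ℝ (fderiv ℝ P) x (Pi.single i 1) (mul a (Pi.single j 1)) +
          fderiv ℝ P x (Pi.single i 1) * fderiv ℝ P x (mul a (Pi.single j 1)) := by
      rw [← hessianAddSq_mulVec, Matrix.mul_apply, Matrix.mulVec, dotProduct]
      simp only [LinearMap.toMatrix'_apply]
    rw [Matrix.of_apply, hij.fderiv]
    simp only [Matrix.sub_apply, Matrix.add_apply, hleft, hright, Matrix.smul_apply,
      Matrix.vecMulVec_apply, smul_eq_mul, hp]
    have h3 := fderiv_fderiv_fderiv_add_mul_apply hP.contDiff hE x a (Pi.single i 1)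
      (Pi.single j 1)
    have h2 := fderiv_fderiv_add_mul_apply hP.contDiff hE x a
    simp only [map_add, add_apply] at h2 h3
    simp [hessianAddSq]
    linear_combination h3 + fderiv ℝ P x (Pi.single i 1) * h2 (Pi.single j 1) +
      fderiv ℝ P x (Pi.single j 1) * h2 (Pi.single i 1)
  rw [hN, Matrix.trace_adjugate_mul_of_mulVec_eq hMr hpr, Fintype.card_fin,
    LinearMap.trace_eq_matrix_trace ℝ (Pi.basisFun ℝ _), LinearMap.toMatrix_eq_toMatrix']

theorem det_hessianAddSq_zero_ne_zero (h : IsLSA mul) (hP : AnalyticOnNhd ℝ P Set.univ)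
    (hE : ∀ x a, fderiv ℝ P x (a + mul a x) = rightTrace mul a * P x) (hP0 : P 0 = 1)
    (hnd : ∀ x, (∀ y, rightTrace mul (mul x y) = 0) → x = 0)
    {r : Fin n → ℝ} (hr : ∀ x, rightTrace mul (mul r x) = rightTrace mul x)
    (htr : rightTrace mul r = 1) : (hessianAddSq P 0).det ≠ 0 := by
  intro hdet
  obtain ⟨w, hw, hMw⟩ := Matrix.exists_mulVec_eq_zero_iff.2 hdet
  refine hw ?_
  have hp : ∀ a, fderiv ℝ P 0 a = rightTrace mul a := fun a => by
    simpa [hP0] using hE 0 a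
  have hq : ∀ a w, fderiv ℝ (fderiv ℝ P) 0 a w =
      rightTrace mul a * rightTrace mul w - rightTrace mul (mul a w) := fun a w => by
    simpa [hp] using fderiv_fderiv_add_mul_apply hP.contDiff hE 0 a w
  let f : (Fin n → ℝ) →ₗ[ℝ] ℝ :=
    (2 * rightTrace mul w) • rightTrace mul - rightTrace mul ∘ₗ mul w
  have hf : f = 0 := by
    refine LinearMap.pi_ext' fun i => LinearMap.ext_ring ?_
    have hi := congrFun hMw i
    rw [hessianAddSq_mulVec, hq, hp, hp, h.rightTrace_mul_comm] at hi
    simp only [Pi.zero_apply] at hi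
    simp [f]
    linear_combination hi
  have hwr : w = (2 * rightTrace mul w) • r := by
    rw [← sub_eq_zero]
    refine hnd _ fun y => ?_
    have hy := LinearMap.congr_fun hf y
    simp [f] at hy
    simp [hr]
    linear_combination -hy
  have hw0 : rightTrace mul w = 2 * rightTrace mul w := by
    have hy := LinearMap.congr_fun hf r
    simp [f] at hy
    rw [h.rightTrace_mul_comm, hr, htr] at hy
    linear_combination -hy
  rw [hwr, show rightTrace mul w = 0 by linarith]
  simp

end Characteristic

theorem stmt0 (n : ℕ) (hn : 1 ≤ n)
    (mul : (Fin n → ℝ) →ₗ[ℝ] (Fin n → ℝ) →ₗ[ℝ] (Fin n → ℝ))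
    (hlsa : IsLSA mul) (htri : Triangularizable mul)
    (τ : (Fin n → ℝ) → (Fin n → ℝ) → ℝ)
    (hτ : ∀ x y, τ x y = LinearMap.trace ℝ (Fin n → ℝ) (mul.flip x ∘ₗ mul.flip y))
    (hnd : ∀ x, (∀ y, τ x y = 0) → x = 0)
    (hder : Module.finrank ℝ
        (Submodule.span ℝ {z : Fin n → ℝ | ∃ x y, z = mul x y - mul y x}) = n - 1)
    (P : (Fin n → ℝ) → ℝ)
    (hP : ∀ x, P x = LinearMap.det (LinearMap.id + mul.flip x))
    (r : Fin n → ℝ)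
    (hr : ∀ x, τ r x = LinearMap.trace ℝ (Fin n → ℝ) (mul.flip x)) :
    mul r r = r ∧
    LinearMap.trace ℝ (Fin n → ℝ) (mul.flip r) = 1 ∧
    (∀ (x : Fin n → ℝ) (t : ℝ), P (x + t • r) = P x + t) ∧
    ∃ κ : ℝ, κ ≠ 0 ∧
      ∀ x : Fin n → ℝ,
        hessianDet (fun y => Real.exp (P y)) x = κ * Real.exp (n * P x) := by
  obtain rfl : P = fun x => LinearMap.det (LinearMap.id + mul.flip x) := funext hP
  have hτ' : ∀ x y, τ x y = rightTrace mul (mul x y) := fun x y => by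
    rw [hτ, ← hlsa.trace_flip_mul, rightTrace, LinearMap.comp_apply]
  simp only [hτ'] at hnd hr
  replace hr : ∀ x, rightTrace mul (mul r x) = rightTrace mul x := hr
  obtain ⟨htr, hxr⟩ := hlsa.mul_right_principal_idempotent hn htri hnd hder hr
  set P : (Fin n → ℝ) → ℝ := fun x => LinearMap.det (LinearMap.id + mul.flip x) with hPdef
  have han : AnalyticOnNhd ℝ P Set.univ := analyticOnNhd_det_id_add_flip
  have hE : ∀ x a, fderiv ℝ P x (a + mul a x) = rightTrace mul a * P x :=
    hlsa.fderiv_det_id_add_flip_apply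
  have hP0 : P 0 = 1 := by simp [hPdef]
  have hPr : ∀ x, fderiv ℝ P x r = 1 := fun x => by
    rw [fderiv_apply_eq_of_mul_eq_smul han hE hxr]
    simpa [hP0, htr] using hE 0 r
  have htrans : ∀ (x : Fin n → ℝ) (t : ℝ), P (x + t • r) = P x + t := by
    intro x t
    have hder : ∀ s : ℝ, HasDerivAt (fun s : ℝ => P (x + s • r) - s) 0 s := fun s => by
      have h1 : HasDerivAt (fun s : ℝ => x + s • r) ((1 : ℝ) • r) s :=
        ((hasDerivAt_id s).smul_const r).const_add x
      have h2 := ((han (x + s • r) trivial).differentiableAt.hasFDerivAt.comp_hasDerivAt s h1).sub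
        (hasDerivAt_id s)
      rw [one_smul, hPr, sub_self] at h2
      exact h2
    have h3 := is_const_of_deriv_eq_zero (fun s => (hder s).differentiableAt)
      (fun s => (hder s).deriv) t 0
    simp at h3
    linear_combination h3
  refine ⟨by rw [hxr, htr, one_smul], htr, htrans, (hessianAddSq P 0).det,
    det_hessianAddSq_zero_ne_zero hlsa han hE hP0 hnd hr htr, fun x => ?_⟩
  rw [hessianDet_exp han.contDiff, mul_comm]
  congr 1
  have hdetan : AnalyticOnNhd ℝ (fun x => (hessianAddSq P x).det) Set.univ :=
    analyticOnNhd_det (analyticOnNhd_hessianAddSq han)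
  have hdet0 := det_hessianAddSq_zero_ne_zero hlsa han hE hP0 hnd hr htr
  let c : (Fin n → ℝ) →ₗ[ℝ] ℝ := ((n : ℝ) + 1) • rightTrace mul -
    (2 : ℝ) • (LinearMap.trace ℝ (Fin n → ℝ) ∘ₗ mul)
  have hc : ∀ x a, fderiv ℝ (fun x => (hessianAddSq P x).det) x (a + mul a x) =
      c a * (hessianAddSq P x).det := fun x a => fderiv_det_hessianAddSq han hE hPr x a
  have hcr : c r = 0 := by
    have hinv : ∀ t : ℝ, hessianAddSq P (t • r) = hessianAddSq P 0 := fun t => by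
      have h1 : (fun y => fderiv ℝ P (y + t • r)) = fderiv ℝ P := by
        ext1 y
        rw [← fderiv_comp_add_right]
        simp only [htrans, fderiv_add_const]
      have h2 : fderiv ℝ P (t • r) = fderiv ℝ P 0 := by
        simpa using congrFun h1 0
      have h3 : fderiv ℝ (fderiv ℝ P) (t • r) = fderiv ℝ (fderiv ℝ P) 0 := by
        conv_rhs => rw [← h1, fderiv_comp_add_right, zero_add]
      simp only [hessianAddSq, h2, h3]
    have h1 := hc 0 r
    rw [map_zero, add_zero] at h1
    have h2 : HasDerivAt (fun t : ℝ => t • r) ((1 : ℝ) • r) 0 := (hasDerivAt_id 0).smul_const r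
    have h3 := (hdetan ((0 : ℝ) • r) trivial).differentiableAt.hasFDerivAt.comp_hasDerivAt 0 h2
    simp only [Function.comp_def, hinv] at h3
    have h5 := h3.unique (hasDerivAt_const 0 _)
    rw [zero_smul, one_smul, h1] at h5
    exact (mul_eq_zero.1 h5).resolve_right hdet0
  have hne : rightTrace mul ≠ 0 := fun h0 => by simp [h0] at htr
  have hc0 : ∀ a, c a = 0 := fun a => by
    have hle : LinearMap.ker (rightTrace mul) ≤ LinearMap.ker c := by
      rw [← hlsa.span_commutator_eq_ker hder hne, Submodule.span_le]
      rintro _ ⟨x, y, rfl⟩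
      have h1 : rightTrace mul (mul x y - mul y x) = 0 := by
        rw [map_sub, hlsa.rightTrace_mul_comm, sub_self]
      have h2 : LinearMap.trace ℝ _ (mul (mul x y - mul y x)) = 0 := by
        rw [hlsa.mul_mul_sub, map_sub, LinearMap.trace_comp_comm', sub_self]
      change (n + 1 : ℝ) * rightTrace mul (mul x y - mul y x) -
        2 * LinearMap.trace ℝ _ (mul (mul x y - mul y x)) = 0
      rw [h1, h2]
      ring
    have h1 : a - rightTrace mul a • r ∈ LinearMap.ker c := hle (by simp [htr])
    rw [LinearMap.mem_ker, map_sub, map_smul, hcr, smul_zero, sub_zero] at h1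
    exact h1
  exact hdetan.eq_apply_zero_of_fderiv_add_mul_eq_zero (mul := mul)
    (fun x a => by rw [hc, hc0, zero_mul]) x
end

section
/- Let λ ∈ ℝ, λ ≠ 0, let Ω ⊆ ℝ^{n+1} be a nonempty open set, let I ⊆ ℝ ∖ {0} be a nonempty connected open subset of ℝ, and let v ∈ ℝ^{n+1}. Let F : Ω → ℝ be continuous on Ω, smooth on Ω ∖ F⁻¹(0), and satisfy F(x + t·v) = e^{λt}·F(x) whenever x ∈ Ω, t ∈ ℝ, and x + t·v ∈ Ω. Suppose φ : I → ℝ is nowhere vanishing on I, that H(F)(x) = φ(F(x)) for all x ∈ F⁻¹(I) ∩ Ω, and that every r ∈ I is attained as a value of F on Ω. Then there is a nonzero constant κ such that φ(r) = κ·r^{n+1} for all r ∈ I. -/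
open Filter Topology

theorem hessianDet_add_of_eventually_eq {m : ℕ} {F : (Fin m → ℝ) → ℝ} {x a : Fin m → ℝ} {c : ℝ}
    (h : ∀ᶠ y in 𝓝 x, F (y + a) = c * F y) :
    hessianDet F (x + a) = c ^ m * hessianDet F x := by
  have hfderiv : ∀ᶠ y in 𝓝 x, fderiv ℝ F (y + a) = c • fderiv ℝ F y := by
    filter_upwards [h.eventually_nhds] with y hy
    have hy' : (fun z => F (z + a)) =ᶠ[𝓝 y] c • F := hy
    rw [← fderiv_comp_add_right, hy'.fderiv_eq, fderiv_const_smul_field]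
    rfl
  have hentry (i j : Fin m) :
      fderiv ℝ (fun y => fderiv ℝ F y (Pi.single j 1)) (x + a) (Pi.single i 1) =
        c * fderiv ℝ (fun y => fderiv ℝ F y (Pi.single j 1)) x (Pi.single i 1) := by
    have hj : (fun y => fderiv ℝ F (y + a) (Pi.single j 1)) =ᶠ[𝓝 x]
        c • fun y => fderiv ℝ F y (Pi.single j 1) := by
      filter_upwards [hfderiv] with y hy
      simp [hy]
    rw [← fderiv_comp_add_right (f := fun y => fderiv ℝ F y (Pi.single j 1)), hj.fderiv_eq,
      fderiv_const_smul_field]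
    rfl
  have hmat : (Matrix.of fun i j : Fin m =>
      fderiv ℝ (fun y => fderiv ℝ F y (Pi.single j 1)) (x + a) (Pi.single i 1)) =
      c • Matrix.of fun i j : Fin m =>
        fderiv ℝ (fun y => fderiv ℝ F y (Pi.single j 1)) x (Pi.single i 1) := by
    ext i j
    exact hentry i j
  rw [hessianDet, hmat, Matrix.det_smul, Fintype.card_fin, hessianDet]

theorem stmt2 (n : ℕ) (lam : ℝ) (hlam : lam ≠ 0)
    (Ω : Set (Fin (n + 1) → ℝ)) (hΩopen : IsOpen Ω) (hΩne : Ω.Nonempty)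
    (I : Set ℝ) (hIopen : IsOpen I) (hIconn : IsPreconnected I) (hIne : I.Nonempty)
    (hI0 : (0 : ℝ) ∉ I)
    (v : Fin (n + 1) → ℝ)
    (F : (Fin (n + 1) → ℝ) → ℝ)
    (hFcont : ContinuousOn F Ω)
    (hFsmooth : ContDiffOn ℝ (⊤ : ℕ∞) F (Ω \ F ⁻¹' {0}))
    (hhom : ∀ x ∈ Ω, ∀ t : ℝ, x + t • v ∈ Ω → F (x + t • v) = Real.exp (lam * t) * F x)
    (φ : ℝ → ℝ) (hφ : ∀ r ∈ I, φ r ≠ 0)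
    (hma : ∀ x ∈ F ⁻¹' I ∩ Ω, hessianDet F x = φ (F x))
    (hattain : ∀ r ∈ I, ∃ x ∈ Ω, F x = r) :
    ∃ κ : ℝ, κ ≠ 0 ∧ ∀ r ∈ I, φ r = κ * r ^ (n + 1) := by
  have hne (r) (hr : r ∈ I) : r ≠ 0 := ne_of_mem_of_not_mem hr hI0
  have hlocal : ∀ r ∈ I, ∀ᶠ s in 𝓝[I] r, φ r / r ^ (n + 1) = φ s / s ^ (n + 1) := by
    intro r hr
    have hr0 := hne r hr
    obtain ⟨x, hx, rfl⟩ := hattain r hr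
    have hratio : ContinuousAt (fun s : ℝ => s / F x) (F x) := by fun_prop
    have hpath : ContinuousAt (fun s => x + (Real.log (s / F x) / lam) • v) (F x) := by
      have hlog : ContinuousAt (fun s => Real.log (s / F x)) (F x) :=
        hratio.log (by simp [hr0])
      fun_prop
    have hmem : ∀ᶠ s in 𝓝 (F x), x + (Real.log (s / F x) / lam) • v ∈ Ω :=
      hpath.eventually_mem (hΩopen.mem_nhds (by simpa [hr0] using hx))
    have hpos : ∀ᶠ s in 𝓝 (F x), 0 < s / F x :=
      hratio.eventually_mem (Ioi_mem_nhds (by simp [hr0]))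
    filter_upwards [hmem.filter_mono nhdsWithin_le_nhds, hpos.filter_mono nhdsWithin_le_nhds,
      self_mem_nhdsWithin] with s hs hs_pos hsI
    set t := Real.log (s / F x) / lam with ht
    have hexp : Real.exp (lam * t) = s / F x := by
      rw [ht, mul_div_cancel₀ _ hlam, Real.exp_log hs_pos]
    have hFs : F (x + t • v) = s := by
      rw [hhom x hx t hs, hexp, div_mul_cancel₀ _ hr0]
    have hscale : ∀ᶠ y in 𝓝 x, F (y + t • v) = s / F x * F y := by
      have hshift : ∀ᶠ y in 𝓝 x, y + t • v ∈ Ω :=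
        (continuous_add_const (t • v)).continuousAt.eventually_mem (hΩopen.mem_nhds hs)
      filter_upwards [hΩopen.mem_nhds hx, hshift] with y hy hyt
      rw [hhom y hy t hyt, hexp]
    have hdet := hessianDet_add_of_eventually_eq hscale
    rw [hma _ ⟨by simpa [hFs] using hsI, hs⟩, hma x ⟨hr, hx⟩, hFs] at hdet
    have hs0 := hne s hsI
    rw [hdet, div_pow]
    field_simp
  have hconst {r s : ℝ} (hr : r ∈ I) (hs : s ∈ I) : φ r / r ^ (n + 1) = φ s / s ^ (n + 1) :=
    hIconn.induction₂ (fun r s => φ r / r ^ (n + 1) = φ s / s ^ (n + 1)) hlocal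
      (fun _ _ _ _ _ _ h h' => h.trans h') (fun _ _ _ _ h => h.symm) hr hs
  obtain ⟨r₀, hr₀⟩ := hIne
  refine ⟨φ r₀ / r₀ ^ (n + 1), div_ne_zero (hφ r₀ hr₀) (pow_ne_zero _ (hne r₀ hr₀)), ?_⟩
  intro r hr
  rw [hconst hr₀ hr, div_mul_cancel₀ _ (pow_ne_zero _ (hne r hr))]
end

section
/- Let n ≥ 1, let κ be a nonzero real number, and let f : ℝⁿ → ℝ be smooth. Define F : ℝⁿ × ℝ → ℝ by F(w,t) = t − f(w), let G = e^F, and on Ω = {(w,t) : t > f(w)} define φ(w,t) = log(t − f(w)). Then the following are equivalent: (i) H(f)(w) = κ for all w ∈ ℝⁿ; (ii) for all (w,t) ∈ ℝⁿ × ℝ, the determinant of the (n+1)×(n+1) matrix with entries ∂²F/∂x_i∂x_j + (∂F/∂x_i)(∂F/∂x_j) equals (−1)ⁿ·κ; (iii) H(G)(w,t) = (−1)ⁿ·κ·G(w,t)^{n+1} for all (w,t) ∈ ℝⁿ × ℝ; (iv) H(φ)(w,t) = (−1)^{n+1}·κ·e^{−(n+2)·φ(w,t)} for all (w,t) ∈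 Ω. -/
open Filter Topology

/-- The determinant of a scaled block-degenerate matrix plus a rank-one matrix. -/
theorem det_smul_add_rank_one_last {n : ℕ} (a b : ℝ) (K : Matrix (Fin n) (Fin n) ℝ)
    (h : Matrix (Fin (n + 1)) (Fin (n + 1)) ℝ) (p : Fin (n + 1) → ℝ)
    (hK : ∀ i j : Fin n, h i.castSucc j.castSucc = -K i j)
    (hrow : ∀ j, h (Fin.last n) j = 0) (hcol : ∀ i, h i (Fin.last n) = 0)
    (hp : p (Fin.last n) = 1) :
    (Matrix.of fun i j => a * h i j + b * (p i * p j)).det = a ^ n * b * ((-1) ^ n * K.det) := by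
  have key : (Matrix.of fun i j => a * h i j + b * (p i * p j)).submatrix
        (finSumFinEquiv : Fin n ⊕ Fin 1 ≃ Fin (n + 1)) finSumFinEquiv =
      Matrix.fromBlocks ((-a) • K) (Matrix.of fun i _ => b * p i.castSucc) 0
          (Matrix.of fun _ _ => b) *
        Matrix.fromBlocks 1 0 (Matrix.of fun _ j => p j.castSucc) 1 := by
    have hlast : ∀ i : Fin 1, Fin.natAdd n i = Fin.last n := fun i => by
      ext; simp
    have hcast : ∀ i : Fin n, Fin.castAdd 1 i = i.castSucc := fun _ => rfl
    rw [Matrix.fromBlocks_multiply]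
    ext (i | i) (j | j) <;>
      simp [hlast, hcast, hK, hrow, hcol, hp, Matrix.mul_apply]
    ring
  rw [← Matrix.det_submatrix_equiv_self finSumFinEquiv, key, Matrix.det_mul,
    Matrix.det_fromBlocks_zero₂₁, Matrix.det_fromBlocks_zero₁₂, Matrix.det_smul]
  simp [neg_pow a]
  ring

/-- Second-order chain rule for a scalar function of a real-valued function. -/
theorem fderiv_fderiv_scalar_comp {E : Type*} [NormedAddCommGroup E] [NormedSpace ℝ E]
    {F : E → ℝ} {g g' : ℝ → ℝ} {g'' : ℝ} {z : E} (u v : E) (hF : Differentiable ℝ F)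
    (hF' : DifferentiableAt ℝ (fun y => fderiv ℝ F y v) z)
    (hg : ∀ᶠ s in 𝓝 (F z), HasDerivAt g (g' s) s) (hg' : HasDerivAt g' g'' (F z)) :
    fderiv ℝ (fun y => fderiv ℝ (fun x => g (F x)) y v) z u =
      g' (F z) * fderiv ℝ (fun y => fderiv ℝ F y v) z u +
        g'' * (fderiv ℝ F z u * fderiv ℝ F z v) := by
  have hev : (fun y => fderiv ℝ (fun x => g (F x)) y v) =ᶠ[𝓝 z]
      fun y => g' (F y) * fderiv ℝ F y v := by
    filter_upwards [hF.continuous.continuousAt.eventually hg] with y hy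
    have hc : HasFDerivAt (fun x => g (F x)) (g' (F y) • fderiv ℝ F y) y :=
      hy.comp_hasFDerivAt y (hF y).hasFDerivAt
    rw [hc.fderiv]
    simp
  have hc : HasFDerivAt (fun y => g' (F y)) (g'' • fderiv ℝ F z) z :=
    hg'.comp_hasFDerivAt z (hF z).hasFDerivAt
  have hm : HasFDerivAt (fun y => g' (F y) * fderiv ℝ F y v) _ z := hc.mul hF'.hasFDerivAt
  rw [hev.fderiv_eq, hm.fderiv]
  simp
  ring

/-- The projection `ℝⁿ⁺¹ → ℝⁿ` forgetting the last coordinate. -/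
noncomputable def initCLM (n : ℕ) : (Fin (n + 1) → ℝ) →L[ℝ] (Fin n → ℝ) :=
  ContinuousLinearMap.pi fun i => ContinuousLinearMap.proj i.castSucc

theorem initCLM_apply {n : ℕ} (z : Fin (n + 1) → ℝ) :
    initCLM n z = fun i => z i.castSucc := rfl

theorem initCLM_single_castSucc {n : ℕ} (i : Fin n) :
    initCLM n (Pi.single i.castSucc 1) = Pi.single i 1 := by
  ext j
  simp [initCLM_apply, Pi.single_apply]

theorem initCLM_single_last (n : ℕ) : initCLM n (Pi.single (Fin.last n) 1) = 0 := by
  ext j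
  simp [initCLM_apply, Fin.castSucc_ne_last]

section LastSub

variable {n : ℕ} {f : (Fin n → ℝ) → ℝ} {F : (Fin (n + 1) → ℝ) → ℝ}

theorem hasFDerivAt_last_sub (hf : Differentiable ℝ f)
    (hF : ∀ z, F z = z (Fin.last n) - f (fun i => z i.castSucc)) (z : Fin (n + 1) → ℝ) :
    HasFDerivAt F (ContinuousLinearMap.proj (Fin.last n) -
      (fderiv ℝ f (initCLM n z)).comp (initCLM n)) z := by
  rw [show F = fun z => ContinuousLinearMap.proj (R := ℝ) (φ := fun _ => ℝ) (Fin.last n) z -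
    f (initCLM n z) from funext hF]
  exact (ContinuousLinearMap.hasFDerivAt _).sub
    ((hf _).hasFDerivAt.comp z (initCLM n).hasFDerivAt)

theorem hasFDerivAt_fderiv_last_sub (hf : ContDiff ℝ 2 f)
    (hF : ∀ z, F z = z (Fin.last n) - f (fun i => z i.castSucc)) (z v : Fin (n + 1) → ℝ) :
    HasFDerivAt (fun y => fderiv ℝ F y v)
      (-(fderiv ℝ (fun w => fderiv ℝ f w (initCLM n v)) (initCLM n z)).comp (initCLM n)) z := by
  have hd : Differentiable ℝ f := hf.differentiable (by norm_num)
  have hd' : Differentiable ℝ fun w => fderiv ℝ f w (initCLM n v) :=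
    ((hf.fderiv_right (m := 1) (by norm_num)).differentiable (by norm_num)).clm_apply
      (differentiable_const _)
  have he : (fun y => fderiv ℝ F y v) =
      fun y => v (Fin.last n) - fderiv ℝ f (initCLM n y) (initCLM n v) := by
    funext y
    rw [(hasFDerivAt_last_sub hd hF y).fderiv]
    simp
  rw [he]
  exact ((hd' _).hasFDerivAt.comp z (initCLM n).hasFDerivAt).const_sub _

/-- The common determinant computation: `D²F` scaled by `a`, plus `b ∇F ∇Fᵀ`. -/
theorem det_hessian_add_rank_one_last_sub (hf : ContDiff ℝ 2 f)
    (hF : ∀ z, F z = z (Fin.last n) - f (fun i => z i.castSucc)) (a b : ℝ)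
    (z : Fin (n + 1) → ℝ) :
    (Matrix.of fun i j : Fin (n + 1) =>
        a * fderiv ℝ (fun y => fderiv ℝ F y (Pi.single j 1)) z (Pi.single i 1) +
          b * (fderiv ℝ F z (Pi.single i 1) * fderiv ℝ F z (Pi.single j 1))).det =
      a ^ n * b * ((-1) ^ n * hessianDet f (initCLM n z)) := by
  have hd : Differentiable ℝ f := hf.differentiable (by norm_num)
  refine det_smul_add_rank_one_last a b _ (Matrix.of fun i j : Fin (n + 1) =>
      fderiv ℝ (fun y => fderiv ℝ F y (Pi.single j 1)) z (Pi.single i 1))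
    (fun i => fderiv ℝ F z (Pi.single i 1)) (fun i j => ?_) (fun j => ?_) (fun i => ?_) ?_
  · simp [(hasFDerivAt_fderiv_last_sub hf hF z _).fderiv, initCLM_single_castSucc]
  · simp [(hasFDerivAt_fderiv_last_sub hf hF z _).fderiv, initCLM_single_last]
  · simp [(hasFDerivAt_fderiv_last_sub hf hF z _).fderiv, initCLM_single_last]
  · simp [(hasFDerivAt_last_sub hd hF z).fderiv, initCLM_single_last]

theorem hessianDet_scalar_comp_last_sub (hf : ContDiff ℝ 2 f)
    (hF : ∀ z, F z = z (Fin.last n) - f (fun i => z i.castSucc))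
    {g g' : ℝ → ℝ} {g'' : ℝ} (z : Fin (n + 1) → ℝ)
    (hg : ∀ᶠ s in 𝓝 (F z), HasDerivAt g (g' s) s) (hg' : HasDerivAt g' g'' (F z)) :
    hessianDet (fun y => g (F y)) z =
      g' (F z) ^ n * g'' * ((-1) ^ n * hessianDet f (initCLM n z)) := by
  rw [← det_hessian_add_rank_one_last_sub hf hF, hessianDet]
  congr 2
  ext i j
  exact fderiv_fderiv_scalar_comp _ _
    (fun y => (hasFDerivAt_last_sub (hf.differentiable (by norm_num)) hF y).differentiableAt)
    (hasFDerivAt_fderiv_last_sub hf hF z _).differentiableAt hg hg'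

theorem hessianDet_exp_last_sub (hf : ContDiff ℝ 2 f)
    (hF : ∀ z, F z = z (Fin.last n) - f (fun i => z i.castSucc)) (z : Fin (n + 1) → ℝ) :
    hessianDet (fun y => Real.exp (F y)) z =
      (-1) ^ n * hessianDet f (initCLM n z) * Real.exp (F z) ^ (n + 1) := by
  rw [hessianDet_scalar_comp_last_sub hf hF z (Eventually.of_forall Real.hasDerivAt_exp)
    (Real.hasDerivAt_exp _)]
  ring

theorem hessianDet_log_last_sub (hf : ContDiff ℝ 2 f)
    (hF : ∀ z, F z = z (Fin.last n) - f (fun i => z i.castSucc)) (z : Fin (n + 1) → ℝ)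
    (hz : 0 < F z) :
    hessianDet (fun y => Real.log (F y)) z =
      (-1) ^ (n + 1) * hessianDet f (initCLM n z) *
        Real.exp (-(n + 2 : ℝ) * Real.log (F z)) := by
  have hexp : Real.exp (-(n + 2 : ℝ) * Real.log (F z)) = ((F z) ^ (n + 2))⁻¹ := by
    rw [neg_mul, Real.exp_neg, mul_comm, ← Real.rpow_def_of_pos hz]
    exact_mod_cast congrArg (·⁻¹) (Real.rpow_natCast (F z) (n + 2))
  rw [hessianDet_scalar_comp_last_sub hf hF z (g' := fun s => s⁻¹)
    ((eventually_ne_nhds hz.ne').mono fun s hs => Real.hasDerivAt_log hs)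
    (hasDerivAt_inv hz.ne'), hexp, inv_pow]
  field_simp
  ring

end LastSub

theorem stmt3 (n : ℕ) (hn : 1 ≤ n) (κ : ℝ) (hκ : κ ≠ 0)
    (f : (Fin n → ℝ) → ℝ) (hf : ContDiff ℝ (⊤ : ℕ∞) f)
    (F : (Fin (n + 1) → ℝ) → ℝ)
    (hF : ∀ z : Fin (n + 1) → ℝ,
      F z = z (Fin.last n) - f (fun i : Fin n => z i.castSucc)) :
    List.TFAE [
      -- (i) H(f) ≡ κ on ℝⁿ
      (∀ w : Fin n → ℝ, hessianDet f w = κ),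
      -- (ii) det(∂²F/∂x_i∂x_j + ∂F/∂x_i · ∂F/∂x_j) ≡ (−1)ⁿ·κ
      (∀ z : Fin (n + 1) → ℝ,
        (Matrix.of fun i j : Fin (n + 1) =>
          fderiv ℝ (fun y => fderiv ℝ F y (Pi.single j 1)) z (Pi.single i 1)
            + fderiv ℝ F z (Pi.single i 1) * fderiv ℝ F z (Pi.single j 1)).det
          = (-1 : ℝ) ^ n * κ),
      -- (iii) H(e^F) = (−1)ⁿ·κ·(e^F)^{n+1}
      (∀ z : Fin (n + 1) → ℝ,
        hessianDet (fun y => Real.exp (F y)) z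
          = (-1 : ℝ) ^ n * κ * Real.exp (F z) ^ (n + 1)),
      -- (iv) H(log F) = (−1)^{n+1}·κ·e^{−(n+2)·log F} on {F > 0}
      (∀ z : Fin (n + 1) → ℝ, 0 < F z →
        hessianDet (fun y => Real.log (F y)) z
          = (-1 : ℝ) ^ (n + 1) * κ * Real.exp (-(n + 2 : ℝ) * Real.log (F z)))] := by
  have hf2 : ContDiff ℝ 2 f := contDiff_infty.mp hf 2
  have lift : ∀ w : Fin n → ℝ, ∃ z, initCLM n z = w ∧ 0 < F z := fun w =>
    ⟨Fin.snoc w (f w + 1), by ext i; simp [initCLM_apply], by simp [hF]⟩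
  have hsign : ∀ k : ℕ, (-1 : ℝ) ^ k ≠ 0 := fun k => pow_ne_zero k (by norm_num)
  have hdet := det_hessian_add_rank_one_last_sub hf2 hF 1 1
  simp only [one_mul, one_pow] at hdet
  tfae_have 1 ↔ 2 := by
    simp only [hdet]
    refine ⟨fun h z => by rw [h], fun h w => ?_⟩
    obtain ⟨z, rfl, -⟩ := lift w
    exact mul_left_cancel₀ (hsign n) (h z)
  tfae_have 1 ↔ 3 := by
    simp only [hessianDet_exp_last_sub hf2 hF]
    refine ⟨fun h z => by rw [h], fun h w => ?_⟩
    obtain ⟨z, rfl, -⟩ := lift w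
    exact mul_left_cancel₀ (hsign n)
      (mul_right_cancel₀ (pow_ne_zero _ (Real.exp_ne_zero _)) (h z))
  tfae_have 1 ↔ 4 := by
    refine ⟨fun h z hz => by rw [hessianDet_log_last_sub hf2 hF z hz, h], fun h w => ?_⟩
    obtain ⟨z, rfl, hz⟩ := lift w
    have hz' := h z hz
    rw [hessianDet_log_last_sub hf2 hF z hz] at hz'
    exact mul_left_cancel₀ (hsign (n + 1)) (mul_right_cancel₀ (Real.exp_ne_zero _) hz')
  tfae_finish
end

section
/- Let F : ℝ^{n+1} → ℝ be smooth and suppose there are a nonzero vector v ∈ ℝ^{n+1} and λ ∈ ℝ such that F(x + t·v) = F(x) + λ·t for all x ∈ ℝ^{n+1} and t ∈ ℝ. Then for every x ∈ ℝ^{n+1} and every c ∈ ℝ, det(M_c(x)) = c·det(M_1(x)), where M_c(x) is the (n+1)×(n+1) matrix with entries ∂²F/∂x_i∂x_j(x) + c·(∂F/∂x_i)(x)·(∂F/∂x_j)(x). -/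
/-- Rank-one perturbations of a matrix with a nonzero left null vector have a determinant that is
homogeneous of degree one in the perturbation. -/
theorem Matrix.det_add_smul_vecMulVec_of_vecMul_eq_zero {ι K : Type*} [Fintype ι] [DecidableEq ι]
    [Field K] (H : Matrix ι ι K) (a b v : ι → K) (hv : v ≠ 0) (h : Matrix.vecMul v H = 0)
    (c : K) :
    (H + c • Matrix.vecMulVec a b).det = c * (H + Matrix.vecMulVec a b).det := by
  obtain ⟨k, hk⟩ := Function.ne_iff.mp hv
  have key (c : K) :
      v k * (H + c • Matrix.vecMulVec a b).det = c * ((v ⬝ᵥ a) * (H.updateRow k b).det) := by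
    have hrow : ∑ i, v i • (H + c • Matrix.vecMulVec a b) i = (c * (v ⬝ᵥ a)) • b := by
      ext j
      have hj : ∑ i, v i * H i j = 0 := congrFun h j
      simp only [Finset.sum_apply, Pi.smul_apply, Matrix.add_apply, Matrix.smul_apply,
        Matrix.vecMulVec_apply, smul_eq_mul, mul_add, Finset.sum_add_distrib, hj, zero_add,
        dotProduct, Finset.mul_sum, Finset.sum_mul]
      exact Finset.sum_congr rfl fun i _ => by ring
    have hdet := Matrix.det_updateRow_sum (H + c • Matrix.vecMulVec a b) k v
    rw [hrow, Matrix.det_updateRow_smul, smul_eq_mul] at hdet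
    rw [← hdet, mul_assoc]
    congr 2
    refine Matrix.det_eq_of_forall_row_eq_smul_add_const
      (Function.update (fun i => c * a i) k 0) k (by simp) fun i j => ?_
    by_cases hi : i = k
    · subst hi; simp
    · simp [hi, Matrix.vecMulVec_apply, mul_assoc]
  apply mul_left_cancel₀ hk
  have h1 := key 1
  rw [one_smul, one_mul] at h1
  rw [key c, mul_left_comm (v k), h1]

/-- If `F` changes by a constant under translation by `w`, its derivative is invariant under
that translation. -/
theorem fderiv_add_eq_of_forall_add_eq {E : Type*} [NormedAddCommGroup E] [NormedSpace ℝ E]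
    {F : E → ℝ} {w : E} {m : ℝ} (h : ∀ x, F (x + w) = F x + m) (x : E) :
    fderiv ℝ F (x + w) = fderiv ℝ F x := by
  rw [← fderiv_comp_add_right, funext h, fderiv_add_const]

/-- A differentiable function invariant under all translations along `v` has vanishing derivative
in the direction `v`. -/
theorem fderiv_apply_eq_zero_of_forall_add_smul_eq {E : Type*} [NormedAddCommGroup E]
    [NormedSpace ℝ E] {G : E → ℝ} {v x : E} (hG : DifferentiableAt ℝ G x)
    (h : ∀ t : ℝ, G (x + t • v) = G x) : fderiv ℝ G x v = 0 := by
  rw [← hG.lineDeriv_eq_fderiv, lineDeriv, funext h, deriv_const]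

theorem stmt4 (n : ℕ)
    (F : (Fin (n + 1) → ℝ) → ℝ) (hF : ContDiff ℝ (⊤ : ℕ∞) F)
    (v : Fin (n + 1) → ℝ) (hv : v ≠ 0) (lam : ℝ)
    (hhom : ∀ (x : Fin (n + 1) → ℝ) (t : ℝ), F (x + t • v) = F x + lam * t) :
    ∀ (x : Fin (n + 1) → ℝ) (c : ℝ),
      (Matrix.of fun i j : Fin (n + 1) =>
        fderiv ℝ (fun y => fderiv ℝ F y (Pi.single j 1)) x (Pi.single i 1)
          + c * (fderiv ℝ F x (Pi.single i 1) * fderiv ℝ F x (Pi.single j 1))).det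
      = c * (Matrix.of fun i j : Fin (n + 1) =>
          fderiv ℝ (fun y => fderiv ℝ F y (Pi.single j 1)) x (Pi.single i 1)
            + 1 * (fderiv ℝ F x (Pi.single i 1) * fderiv ℝ F x (Pi.single j 1))).det := by
  intro x c
  let H : Matrix (Fin (n + 1)) (Fin (n + 1)) ℝ := Matrix.of fun i j =>
    fderiv ℝ (fun y => fderiv ℝ F y (Pi.single j 1)) x (Pi.single i 1)
  let a : Fin (n + 1) → ℝ := fun i => fderiv ℝ F x (Pi.single i 1)
  have hH : Matrix.vecMul v H = 0 := by
    ext j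
    have hd : Differentiable ℝ fun y => fderiv ℝ F y (Pi.single j 1) :=
      ((hF.fderiv_right (m := 1) (by norm_cast)).differentiable one_ne_zero).clm_apply
        (differentiable_const _)
    have hz := fderiv_apply_eq_zero_of_forall_add_smul_eq (v := v) (hd x) fun t => by
      rw [fderiv_add_eq_of_forall_add_eq fun y => hhom y t]
    rw [pi_eq_sum_univ' v, map_sum] at hz
    simpa [Matrix.vecMul, dotProduct, H, Pi.single_apply] using hz
  have := Matrix.det_add_smul_vecMulVec_of_vecMul_eq_zero H a a v hv hH c
  have hM (d : ℝ) : (Matrix.of fun i j : Fin (n + 1) => H i j + d * (a i * a j))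
      = H + d • Matrix.vecMulVec a a := by
    ext i j
    simp [Matrix.vecMulVec_apply]
  have hc := hM c
  have h1 := hM 1
  rw [one_smul] at h1
  rw [← hc, ← h1] at this
  exact this
end

section
/- For n ≥ 1 define R_n : (Fin n → ℝ) → Matrix (Fin n) (Fin n) ℝ by: (R_n(x))_{i,j} = x_{i−j} whenever 1 ≤ j < i ≤ n and j ≤ n−1, (R_n(x))_{i,n} = i·x_i for 1 ≤ i ≤ n, and all other entries equal to 0; and let P_n(x) = det(I_n + R_n(x)). Then P_1(x) = 1 + x_1, and for every n ≥ 2 and x ∈ Fin n → ℝ, P_n(x_1,…,x_n) − 1 = Σ_{i=1}^{n−1} x_i·(1 − P_{n−i}(x_1,…,x_{n−i})) + n·x_n. -/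
/-- The right multiplication matrix of the n-dimensional Cayley left-symmetric
algebra: in 1-based indexing, entry (i,j) = x_{i−j} for 1 ≤ j < i ≤ n with
j ≤ n−1, entry (i,n) = i·x_i, and all other entries 0. -/
def cayleyR (n : ℕ) (x : Fin n → ℝ) : Matrix (Fin n) (Fin n) ℝ :=
  Matrix.of fun i j : Fin n =>
    if j.val = n - 1 then (i.val + 1 : ℝ) * x i
    else if j < i then
      x ⟨i.val - j.val - 1,
        lt_of_le_of_lt (le_trans (Nat.sub_le _ _) (Nat.sub_le _ _)) i.isLt⟩
    else 0

/-- The characteristic polynomial P_n(x) = det(I + R_n(x)). -/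
noncomputable def cayleyP (n : ℕ) (x : Fin n → ℝ) : ℝ :=
  (1 + cayleyR n x).det

/-- The coefficients of `u' / u` for `u = 1 + ∑ y i * t ^ (i + 1)`. -/
noncomputable def logDerivCoeff (y : ℕ → ℝ) (i : ℕ) : ℝ :=
  (i + 1) * y i - ∑ k : Fin i, y (i - k - 1) * logDerivCoeff y k
decreasing_by exact k.isLt

/-- The unipotent lower triangular Toeplitz matrix with subdiagonal entries `y 0, y 1, …`. -/
def unipotentToeplitz (n : ℕ) (y : ℕ → ℝ) : Matrix (Fin n) (Fin n) ℝ :=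
  Matrix.of fun i j => if i = j then 1 else if j < i then y (i - j - 1) else 0

theorem det_unipotentToeplitz (n : ℕ) (y : ℕ → ℝ) : (unipotentToeplitz n y).det = 1 := by
  rw [Matrix.det_of_isLowerTriangular]
  · simp [unipotentToeplitz]
  · intro i j hij
    have hij : i < j := hij
    simp [unipotentToeplitz, hij.ne, hij.not_gt]

theorem unipotentToeplitz_mulVec_logDerivCoeff (n : ℕ) (y : ℕ → ℝ) (i : Fin n) :
    (unipotentToeplitz n y).mulVec (fun k => logDerivCoeff y k) i = (i + 1) * y i := by
  have h : ∀ k : Fin n, unipotentToeplitz n y i k * logDerivCoeff y k =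
      (if i = k then logDerivCoeff y k else 0) +
        if (k : ℕ) < i then y (i - k - 1) * logDerivCoeff y k else 0 := by
    intro k
    by_cases hik : i = k
    · simp [unipotentToeplitz, hik]
    · simp [unipotentToeplitz, hik]
  simp only [Matrix.mulVec, dotProduct, h, Finset.sum_add_distrib]
  rw [Fin.sum_univ_eq_sum_range
    (fun k => if k < (i : ℕ) then y (i - k - 1) * logDerivCoeff y k else 0) n,
    ← Finset.sum_filter (s := Finset.range n)]
  have hf : (Finset.range n).filter (fun k => k < (i : ℕ)) = Finset.range i := by
    ext k
    simp only [Finset.mem_filter, Finset.mem_range]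
    omega
  rw [hf, ← Fin.sum_univ_eq_sum_range (fun k => y (i - k - 1) * logDerivCoeff y k)]
  simp only [Finset.sum_ite_eq, Finset.mem_univ, if_true]
  rw [logDerivCoeff]
  ring

theorem one_add_cayleyR_eq_mul (n : ℕ) (y : ℕ → ℝ) :
    1 + cayleyR (n + 1) (fun k => y k) = unipotentToeplitz (n + 1) y *
      (1 + Matrix.vecMulVec (fun k : Fin (n + 1) => logDerivCoeff y k)
        (Pi.single (Fin.last n) 1)) := by
  rw [mul_add, mul_one, Matrix.mul_vecMulVec]
  ext i j
  rw [Matrix.add_apply, Matrix.add_apply, Matrix.vecMulVec_apply,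
    unipotentToeplitz_mulVec_logDerivCoeff]
  by_cases hj : j = Fin.last n
  · subst hj
    simp [cayleyR, unipotentToeplitz, Matrix.one_apply, (Fin.le_last i).not_gt]
  · have hj' : (j : ℕ) ≠ n := fun h => hj (Fin.ext h)
    by_cases hij : i = j
    · subst hij
      simp [cayleyR, unipotentToeplitz, hj, hj']
    · simp [cayleyR, unipotentToeplitz, hij, hj, hj']

theorem cayleyP_eq_one_add_logDerivCoeff {n : ℕ} (hn : 0 < n) (y : ℕ → ℝ) :
    cayleyP n (fun k => y k) = 1 + logDerivCoeff y (n - 1) := by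
  obtain ⟨n, rfl⟩ := Nat.exists_eq_add_of_lt hn
  rw [zero_add, cayleyP, one_add_cayleyR_eq_mul, Matrix.det_mul, det_unipotentToeplitz, one_mul,
    Matrix.vecMulVec_eq Unit, Matrix.det_one_add_replicateCol_mul_replicateRow]
  simp

theorem stmt18 :
    (∀ x : Fin 1 → ℝ, cayleyP 1 x = 1 + x 0) ∧
    (∀ (n : ℕ) (hn : 2 ≤ n) (x : Fin n → ℝ),
      cayleyP n x - 1 =
        (∑ i : Fin (n - 1),
          x ⟨i.val, lt_of_lt_of_le i.isLt (Nat.sub_le n 1)⟩ *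
            (1 - cayleyP (n - 1 - i.val)
              (fun k : Fin (n - 1 - i.val) =>
                x ⟨k.val, lt_of_lt_of_le k.isLt
                  (le_trans (Nat.sub_le _ _) (Nat.sub_le _ _))⟩))) +
          n * x ⟨n - 1, by omega⟩) := by
  refine ⟨fun x => by simp [cayleyP, cayleyR], ?_⟩
  intro n hn x
  obtain ⟨m, rfl⟩ : ∃ m, n = m + 1 := ⟨n - 1, by omega⟩
  obtain ⟨y, rfl⟩ : ∃ y : ℕ → ℝ, x = fun k : Fin (m + 1) => y k :=
    ⟨fun k => if h : k < m + 1 then x ⟨k, h⟩ else 0, by ext k; simp only [k.isLt, dif_pos]⟩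
  have h : ∀ i : Fin m, cayleyP (m + 1 - 1 - i) (fun k : Fin (m + 1 - 1 - i) => y k) =
      1 + logDerivCoeff y (Fin.rev i) := by
    intro i
    rw [cayleyP_eq_one_add_logDerivCoeff (by grind)]
    congr 2
  have hy : ∀ k : Fin m, y (m - Fin.rev k - 1) = y k := by
    intro k
    congr 1
    grind
  change cayleyP (m + 1) (fun k => y k) - 1 =
    ∑ i : Fin m, y i * (1 - cayleyP (m + 1 - 1 - i) fun k => y k) + (m + 1 : ℕ) * y m
  simp only [h]
  rw [cayleyP_eq_one_add_logDerivCoeff m.succ_pos, add_sub_cancel_left, Nat.succ_sub_one,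
    logDerivCoeff, ← Equiv.sum_comp Fin.revPerm]
  simp only [hy, Fin.revPerm_apply, sub_add_cancel_left, mul_neg, Finset.sum_neg_distrib]
  push_cast
  ring
end

section
/- For n ≥ 1 define R_n : (Fin n → ℝ) → Matrix (Fin n) (Fin n) ℝ by: (R_n(x))_{i,j} = x_{i−j} whenever 1 ≤ j < i ≤ n and j ≤ n−1, (R_n(x))_{i,n} = i·x_i for 1 ≤ i ≤ n, and all other entries equal to 0; and let P_n(x) = det(I_n + R_n(x)). Then the function e^{P_n} : (Fin n → ℝ) → ℝ satisfies H(e^{P_n})(x) = (−1)^{n(n−1)/2} · n^{n+1} · e^{n·P_n(x)} for every x ∈ Fin n → ℝ. -/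
open PowerSeries

/-- The power series `F'` is the coefficientwise directional derivative at `x` along `v` of the
family of power series `F`. -/
def HasCoeffDeriv {E : Type*} [NormedAddCommGroup E] [NormedSpace ℝ E]
    (F : E → ℝ⟦X⟧) (F' : ℝ⟦X⟧) (x v : E) : Prop :=
  ∀ k, DifferentiableAt ℝ (fun y => coeff k (F y)) x ∧
    fderiv ℝ (fun y => coeff k (F y)) x v = coeff k F'

namespace HasCoeffDeriv

variable {E : Type*} [NormedAddCommGroup E] [NormedSpace ℝ E] {F G : E → ℝ⟦X⟧} {F' G' : ℝ⟦X⟧}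
  {x v : E}

theorem const (f : ℝ⟦X⟧) : HasCoeffDeriv (fun _ : E => f) 0 x v := fun k => by
  simp

theorem unique (h₁ : HasCoeffDeriv F F' x v) (h₂ : HasCoeffDeriv F G' x v) : F' = G' := by
  ext k
  rw [← (h₁ k).2, (h₂ k).2]

theorem mul (hF : HasCoeffDeriv F F' x v) (hG : HasCoeffDeriv G G' x v) :
    HasCoeffDeriv (fun y => F y * G y) (F' * G x + F x * G') x v := fun k => by
  have h : HasFDerivAt (fun y => coeff k (F y * G y))
      (∑ p ∈ Finset.HasAntidiagonal.antidiagonal k,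
        (coeff p.1 (F x) • fderiv ℝ (fun y => coeff p.2 (G y)) x +
          coeff p.2 (G x) • fderiv ℝ (fun y => coeff p.1 (F y)) x)) x := by
    simp only [coeff_mul]
    exact HasFDerivAt.fun_sum fun p _ => (hF p.1).1.hasFDerivAt.mul (hG p.2).1.hasFDerivAt
  refine ⟨h.differentiableAt, ?_⟩
  rw [h.fderiv, map_add, coeff_mul, coeff_mul, ← Finset.sum_add_distrib]
  simp only [sum_apply, add_apply,
    smul_apply, smul_eq_mul]
  refine Finset.sum_congr rfl fun p _ => ?_
  rw [(hF p.1).2, (hG p.2).2]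
  ring

theorem derivative (hF : HasCoeffDeriv F F' x v) :
    HasCoeffDeriv (fun y => d⁄dX ℝ (F y)) (d⁄dX ℝ F') x v := fun k => by
  simp only [coeff_derivative]
  refine ⟨(hF (k + 1)).1.mul_const _, ?_⟩
  rw [fderiv_mul_const (hF (k + 1)).1, smul_apply, (hF (k + 1)).2,
    smul_eq_mul, mul_comm]

theorem inv (hF : HasCoeffDeriv F F' x v) (h1 : ∀ y, constantCoeff (F y) = 1) :
    HasCoeffDeriv (fun y => (F y)⁻¹) (-(F' * (F x)⁻¹ ^ 2)) x v := by
  have hd : ∀ k, DifferentiableAt ℝ (fun y => coeff k (F y)⁻¹) x := fun k => by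
    induction k using Nat.strong_induction_on with
    | _ k ih =>
      have e : (fun y => coeff k (F y)⁻¹) = fun y => _ :=
        funext fun y => PowerSeries.coeff_inv k (F y)
      simp only [h1] at e
      rw [e]
      split_ifs
      · fun_prop
      · refine DifferentiableAt.const_mul (DifferentiableAt.fun_sum fun p _ => ?_) _
        split_ifs with hp
        · exact (hF p.1).1.mul (ih _ hp)
        · fun_prop
  have hG : HasCoeffDeriv (fun y => (F y)⁻¹)
      (PowerSeries.mk fun k => fderiv ℝ (fun y => coeff k (F y)⁻¹) x v) x v :=
    fun k => ⟨hd k, by rw [coeff_mk]⟩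
  have hc : ∀ y, F y * (F y)⁻¹ = 1 := fun y => PowerSeries.mul_inv_cancel _ (by simp [h1])
  have h := hF.mul hG
  simp only [hc] at h
  have h0 := h.unique (const 1)
  convert hG using 1
  linear_combination (-(F x)⁻¹) * h0 +
    (PowerSeries.mk fun k => fderiv ℝ (fun y => coeff k (F y)⁻¹) x v) * hc x

end HasCoeffDeriv

/-- The power series `1 + ∑ yᵢ X ^ (i + 1)`. -/
noncomputable def unitSeries {n : ℕ} (y : Fin n → ℝ) : ℝ⟦X⟧ :=
  PowerSeries.mk fun k => if k = 0 then 1 else if h : k - 1 < n then y ⟨k - 1, h⟩ else 0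

theorem coeff_zero_unitSeries {n : ℕ} (y : Fin n → ℝ) : coeff 0 (unitSeries y) = 1 := by
  simp [unitSeries]

theorem constantCoeff_unitSeries {n : ℕ} (y : Fin n → ℝ) :
    constantCoeff (unitSeries y) = 1 := by
  rw [← coeff_zero_eq_constantCoeff_apply, coeff_zero_unitSeries]

theorem coeff_succ_unitSeries {n : ℕ} (y : Fin n → ℝ) (i : Fin n) :
    coeff (i.val + 1) (unitSeries y) = y i := by
  simp [unitSeries]

theorem unitSeries_mul_inv {n : ℕ} (y : Fin n → ℝ) : unitSeries y * (unitSeries y)⁻¹ = 1 :=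
  PowerSeries.mul_inv_cancel _ (by simp [constantCoeff_unitSeries])

theorem hasCoeffDeriv_unitSeries {n : ℕ} (x : Fin n → ℝ) (i : Fin n) :
    HasCoeffDeriv unitSeries (X ^ (i.val + 1)) x (Pi.single i 1) := fun k => by
  simp only [unitSeries, coeff_mk, coeff_X_pow]
  split_ifs with h0 h2 h1 h2 h2
  · omega
  · simp
  · refine ⟨by fun_prop, ?_⟩
    rw [(hasFDerivAt_apply _ _).fderiv]
    obtain rfl : (⟨k - 1, h1⟩ : Fin n) = i := Fin.ext (by simp; omega)
    simp
  · refine ⟨by fun_prop, ?_⟩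
    rw [(hasFDerivAt_apply _ _).fderiv]
    have : (⟨k - 1, h1⟩ : Fin n) ≠ i := fun h => h2 (by rw [← h]; simp; omega)
    simp [this]
  · omega
  · simp

theorem hasCoeffDeriv_unitSeries_inv {n : ℕ} (x : Fin n → ℝ) (i : Fin n) :
    HasCoeffDeriv (fun y => (unitSeries y)⁻¹) (-(X ^ (i.val + 1) * (unitSeries x)⁻¹ ^ 2)) x
      (Pi.single i 1) :=
  (hasCoeffDeriv_unitSeries x i).inv constantCoeff_unitSeries

theorem sum_fin_coeff_mul_coeff {n : ℕ} (f g : ℝ⟦X⟧) (i : Fin n) :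
    ∑ j : Fin n, (if j ≤ i then coeff (i.val - j.val) f else 0) * coeff j.val g =
      coeff i.val (f * g) := by
  simp only [Fin.le_def]
  rw [Fin.sum_univ_eq_sum_range
      (fun j => (if j ≤ i.val then coeff (i.val - j) f else 0) * coeff j g) n,
    mul_comm f g, coeff_mul,
    Finset.Nat.sum_antidiagonal_eq_sum_range_succ (fun a b => coeff a g * coeff b f)]
  symm
  apply Finset.sum_subset_zero_on_sdiff
  · intro j
    simp only [Finset.mem_range]
    omega
  · intro j hj
    simp only [Finset.mem_sdiff, Finset.mem_range] at hj
    rw [if_neg (by omega), zero_mul]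
  · intro j hj
    simp only [Finset.mem_range] at hj
    rw [if_pos (by omega), mul_comm]

/-- `P_n - 1` is the degree `n - 1` coefficient of the logarithmic derivative of
`1 + ∑ xᵢ X ^ (i + 1)`. -/
theorem cayleyP_succ (m : ℕ) (y : Fin (m + 1) → ℝ) :
    cayleyP (m + 1) y = 1 + coeff m (d⁄dX ℝ (unitSeries y) * (unitSeries y)⁻¹) := by
  set T : Matrix (Fin (m + 1)) (Fin (m + 1)) ℝ := Matrix.of fun i j =>
    if j ≤ i then coeff (i.val - j.val) (unitSeries y) else 0 with hT
  set g : ℝ⟦X⟧ := d⁄dX ℝ (unitSeries y) * (unitSeries y)⁻¹ with hg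
  set w : Fin (m + 1) → ℝ := (fun j => coeff j.val g) + Pi.single (Fin.last m) 1 with hw
  have hdet : T.det = 1 := by
    rw [Matrix.det_of_isLowerTriangular T]
    · simp [hT, coeff_zero_unitSeries]
    · intro i j hij
      have : i < j := hij
      simp [hT, this]
  have hTw : ∀ i, (T.mulVec w) i =
      (i.val + 1 : ℝ) * y i + if i = Fin.last m then 1 else 0 := fun i => by
    rw [hw, Matrix.mulVec_add, Pi.add_apply]
    congr 1
    · have hmul : unitSeries y * g = d⁄dX ℝ (unitSeries y) := by
        linear_combination d⁄dX ℝ (unitSeries y) * unitSeries_mul_inv y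
      have := sum_fin_coeff_mul_coeff (unitSeries y) g i
      rw [hmul, coeff_derivative, coeff_succ_unitSeries] at this
      rw [mul_comm, ← this]
      rfl
    · rw [Matrix.mulVec_single_one]
      by_cases h : i = Fin.last m
      · simp [hT, h, coeff_zero_unitSeries]
      · simp [hT, h]
  have hM : 1 + cayleyR (m + 1) y = T.updateCol (Fin.last m) (T.mulVec w) := by
    ext i j
    rw [Matrix.updateCol_apply, hTw, Matrix.add_apply, Matrix.one_apply]
    by_cases hj : j = Fin.last m
    · subst hj
      simp [cayleyR, add_comm]
    · have hj' : j.val ≠ m := fun h => hj (Fin.ext h)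
      simp only [cayleyR, Matrix.of_apply, hj, hT, Nat.add_sub_cancel, hj', if_false]
      rcases lt_trichotomy i j with h | h | h
      · simp [h.ne, h.not_gt, h.not_ge]
      · simp [h, coeff_zero_unitSeries]
      · have := coeff_succ_unitSeries y ⟨i.val - j.val - 1, by omega⟩
        have e : i.val - j.val - 1 + 1 = i.val - j.val := by
          have := Fin.lt_def.1 h
          omega
        simp only [e] at this
        simp [h.ne', h, h.le, this]
  rw [cayleyP, hM, ← Matrix.cramer_apply, Matrix.cramer_eq_adjugate_mulVec, Matrix.mulVec_mulVec,
    Matrix.adjugate_mul, hdet, one_smul, Matrix.one_mulVec]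
  simp [hw, add_comm]

theorem differentiableAt_and_fderiv_cayleyP (m : ℕ) (y : Fin (m + 1) → ℝ) (i : Fin (m + 1)) :
    DifferentiableAt ℝ (cayleyP (m + 1)) y ∧
      fderiv ℝ (cayleyP (m + 1)) y (Pi.single i 1) =
        (m + 1) * coeff (m - i.val) (unitSeries y)⁻¹ := by
  have hA := hasCoeffDeriv_unitSeries y i
  have hB := hasCoeffDeriv_unitSeries_inv y i
  obtain ⟨h₁, h₂⟩ := hA.derivative.mul hB m
  rw [funext (cayleyP_succ m)]
  refine ⟨h₁.const_add 1, ?_⟩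
  rw [fderiv_const_add, h₂]
  have hinv : d⁄dX ℝ (unitSeries y)⁻¹ = -(unitSeries y)⁻¹ ^ 2 * d⁄dX ℝ (unitSeries y) :=
    PowerSeries.derivative_inv' _
  have : d⁄dX ℝ (X ^ (i.val + 1)) * (unitSeries y)⁻¹ +
      d⁄dX ℝ (unitSeries y) * -(X ^ (i.val + 1) * (unitSeries y)⁻¹ ^ 2) =
      d⁄dX ℝ (X ^ (i.val + 1) * (unitSeries y)⁻¹) := by
    rw [Derivation.leibniz, hinv, smul_eq_mul, smul_eq_mul]
    ring
  rw [this, coeff_derivative, coeff_X_pow_mul', if_pos (by omega), Nat.add_sub_add_right, mul_comm]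

theorem fderiv_fderiv_exp_cayleyP (m : ℕ) (x : Fin (m + 1) → ℝ) (i j : Fin (m + 1)) :
    fderiv ℝ (fun y => fderiv ℝ (fun z => Real.exp (cayleyP (m + 1) z)) y (Pi.single j 1)) x
      (Pi.single i 1) =
    Real.exp (cayleyP (m + 1) x) *
      ((m + 1) ^ 2 * coeff (m - i.val) (unitSeries x)⁻¹ * coeff (m - j.val) (unitSeries x)⁻¹ -
        (m + 1) * coeff (m - j.val) (X ^ (i.val + 1) * (unitSeries x)⁻¹ ^ 2)) := by
  have h : ∀ y, fderiv ℝ (fun z => Real.exp (cayleyP (m + 1) z)) y (Pi.single j 1) =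
      Real.exp (cayleyP (m + 1) y) * ((m + 1) * coeff (m - j.val) (unitSeries y)⁻¹) := fun y => by
    obtain ⟨h₁, h₂⟩ := differentiableAt_and_fderiv_cayleyP m y j
    rw [fderiv_exp h₁, smul_apply, h₂, smul_eq_mul]
  simp only [h]
  obtain ⟨h₁, h₂⟩ := differentiableAt_and_fderiv_cayleyP m x i
  obtain ⟨h₃, h₄⟩ := hasCoeffDeriv_unitSeries_inv x i (m - j.val)
  rw [fderiv_fun_mul h₁.exp (h₃.const_mul _), fderiv_exp h₁, fderiv_const_mul h₃]
  simp only [add_apply, smul_apply, smul_eq_mul, h₂, h₄,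
    map_neg]
  ring

theorem neg_one_pow_succ_mul_div_two (m : ℕ) :
    (-1 : ℝ) ^ ((m + 1) * m / 2) = (-1) ^ m * (-1) ^ (m * (m - 1) / 2) := by
  rw [← pow_add, add_comm m (m * (m - 1) / 2), ← Nat.triangle_succ, Nat.add_sub_cancel]

theorem Matrix.det_of_antitriangular (d : ℝ) (m : ℕ) (N : Matrix (Fin m) (Fin m) ℝ)
    (h0 : ∀ i j, m ≤ i.val + j.val → N i j = 0)
    (hd : ∀ i j, i.val + j.val + 1 = m → N i j = d) :
    N.det = (-1) ^ (m * (m - 1) / 2) * d ^ m := by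
  induction m with
  | zero => simp
  | succ m ih =>
    rw [Matrix.det_succ_row N (Fin.last m), Finset.sum_eq_single 0]
    · rw [hd _ _ (by simp), ih]
      · rw [Nat.add_sub_cancel, neg_one_pow_succ_mul_div_two]
        simp
        ring
      · intro i j hij
        exact h0 _ _ (by simp; omega)
      · intro i j hij
        exact hd _ _ (by simp; omega)
    · intro j _ hj
      have : j.val ≠ 0 := fun h => hj (Fin.ext h)
      rw [h0 _ _ (by simp; omega)]
      simp
    · simp

theorem det_outer_product_sub_coeff (m : ℕ) (f g : ℝ⟦X⟧) (hf : coeff 0 f = 1) (hg : coeff 0 g = 1) :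
    (Matrix.of fun i j : Fin (m + 1) =>
      ((m + 1 : ℝ) ^ 2 * coeff (m - i.val) f * coeff (m - j.val) f -
        (m + 1) * coeff (m - j.val) (X ^ (i.val + 1) * g))).det =
      (-1) ^ ((m + 1) * m / 2) * (m + 1 : ℝ) ^ (m + 2) := by
  set B : Matrix (Fin (m + 1)) (Fin (m + 1)) ℝ := Matrix.of fun i j =>
    if i = Fin.last m then (m + 1 : ℝ) ^ 2 * coeff (m - j.val) f
    else -((m + 1) * coeff (m - j.val) (X ^ (i.val + 1) * g)) with hB
  rw [Matrix.det_eq_of_forall_row_eq_smul_add_const (B := B)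
    (fun i => if i = Fin.last m then 0 else coeff (m - i.val) f) (Fin.last m) (by simp)]
  · rw [Matrix.det_succ_column B (Fin.last m), Finset.sum_eq_single (Fin.last m),
      Matrix.det_of_antitriangular (-(m + 1)) m, neg_one_pow_succ_mul_div_two]
    · rw [neg_pow (m + 1 : ℝ) m]
      simp [hB, hf]
      ring
    · intro i j hij
      simp [hB, coeff_X_pow_mul', Fin.castSucc_ne_last]
      omega
    · intro i j hij
      have : m - j.val = i.val + 1 := by omega
      simp [hB, coeff_X_pow_mul', Fin.castSucc_ne_last, this, hg]
    · intro i _ hi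
      simp [hB, hi, coeff_X_pow_mul']
    · simp
  · intro i j
    by_cases hi : i = Fin.last m
    · subst hi
      simp [hB, hf, coeff_X_pow_mul']
    · simp [hB, hi]
      ring

theorem stmt19 (n : ℕ) (hn : 1 ≤ n) (x : Fin n → ℝ) :
    hessianDet (fun y => Real.exp (cayleyP n y)) x =
      (-1 : ℝ) ^ (n * (n - 1) / 2) * (n : ℝ) ^ (n + 1) *
        Real.exp (n * cayleyP n x) := by
  obtain ⟨m, rfl⟩ := Nat.exists_eq_add_of_le' hn
  have h0 : coeff 0 (unitSeries x)⁻¹ = 1 := by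
    simp [constantCoeff_unitSeries]
  rw [hessianDet]
  simp only [fderiv_fderiv_exp_cayleyP]
  have := det_outer_product_sub_coeff m (unitSeries x)⁻¹ ((unitSeries x)⁻¹ ^ 2) h0
    (by simp [constantCoeff_unitSeries])
  have hs := Matrix.det_smul (Matrix.of fun i j : Fin (m + 1) =>
      ((m + 1 : ℝ) ^ 2 * coeff (m - i.val) (unitSeries x)⁻¹ * coeff (m - j.val) (unitSeries x)⁻¹ -
        (m + 1) * coeff (m - j.val) (X ^ (i.val + 1) * (unitSeries x)⁻¹ ^ 2)))
      (Real.exp (cayleyP (m + 1) x))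
  rw [this, Fintype.card_fin, ← Real.exp_nat_mul] at hs
  rw [Nat.add_sub_cancel]
  push_cast at hs ⊢
  rw [mul_comm, ← hs]
  rfl
end
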